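/- Let 1 < p < ∞ and let ρ satisfy (H0)–(H4) and have compact support. Then there exists a constant c_p > 0 such that for every u ∈ C_c^∞(ℝ^n; ℝ^n), ‖(D_ρ u)_sym‖_{L^p(ℝ^n; ℝ^{n×n})} ≥ c_p ‖D_ρ u‖_{L^p(ℝ^n; ℝ^{n×n})}. (Nonlocal Korn inequality for general kernels.) -/

import Mathlib

open MeasureTheory Metric Set Matrix
open scoped ENNReal InnerProductSpace

noncomputable section

/-- Points of `ℝ^n` with the Euclidean norm. -/
abbrev Eu (n : ℕ) := EuclideanSpace ℝ (Fin n)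

/-- Hypothesis (H0): `ρ` is a nonnegative radial kernel (with radial representation `ρb`),
locally integrable, with `∫ min{1,|x|⁻¹} ρ(x) dx < ∞`, and bounded below away from zero
on a closed ball of some radius `ε > 0`. -/
def IsKernelH0 (n : ℕ) (ρ : Eu n → ℝ) (ρb : ℝ → ℝ) (ε : ℝ) : Prop :=
  (∀ x, 0 ≤ ρ x) ∧
  (∀ x : Eu n, x ≠ 0 → ρ x = ρb ‖x‖) ∧
  LocallyIntegrable ρ volume ∧
  Integrable (fun x : Eu n => min 1 ‖x‖⁻¹ * ρ x) volume ∧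
  0 < ε ∧
  ∃ c > (0 : ℝ), ∀ x ∈ closedBall (0 : Eu n) ε, x ≠ 0 → c ≤ ρ x

/-- The auxiliary function `f_ρ(r) = r^(n-2) ρ̄(r)`. -/
def fRho (n : ℕ) (ρb : ℝ → ℝ) (r : ℝ) : ℝ := r ^ ((n : ℝ) - 2) * ρb r

/-- Hypothesis (H1): `f_ρ` and `r ↦ r^ν f_ρ(r)` are decreasing on `(0, ε)` for some `ν > 0`. -/
def IsKernelH1 (n : ℕ) (ρb : ℝ → ℝ) (ε : ℝ) : Prop :=
  ∃ ν > (0 : ℝ), AntitoneOn (fRho n ρb) (Ioo 0 ε) ∧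
    AntitoneOn (fun r => r ^ ν * fRho n ρb r) (Ioo 0 ε)

/-- Hypothesis (H2): `f_ρ` is smooth away from the origin and its derivatives satisfy
`|f_ρ^{(k)}(r)| ≤ C(k) r^(-k) f_ρ(r)` on `(0, ε)`. -/
def IsKernelH2 (n : ℕ) (ρb : ℝ → ℝ) (ε : ℝ) : Prop :=
  ContDiffOn ℝ (⊤ : ℕ∞) (fRho n ρb) (Ioi 0) ∧
  ∀ k : ℕ, 0 < k → ∃ C > (0 : ℝ), ∀ r ∈ Ioo (0 : ℝ) ε,
    |iteratedDerivWithin k (fRho n ρb) (Ioi 0) r| ≤ C * r ^ (-(k : ℝ)) * fRho n ρb r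

/-- Hypothesis (H3): `r ↦ r^(n+s-1) ρ̄(r)` is almost decreasing on `(0, ε)` for some `s ∈ (0,1)`. -/
def IsKernelH3 (n : ℕ) (ρb : ℝ → ℝ) (ε : ℝ) : Prop :=
  ∃ s ∈ Ioo (0 : ℝ) 1, ∃ C > (0 : ℝ), ∀ r₁ ∈ Ioo (0 : ℝ) ε, ∀ r₂ ∈ Ioo (0 : ℝ) ε, r₁ ≤ r₂ →
    C * (r₂ ^ ((n : ℝ) + s - 1) * ρb r₂) ≤ r₁ ^ ((n : ℝ) + s - 1) * ρb r₁

/-- Hypothesis (H4): `r ↦ r^(n+t-1) ρ̄(r)` is almost increasing on `(0, ε)` for some `t ∈ (0,1)`. -/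
def IsKernelH4 (n : ℕ) (ρb : ℝ → ℝ) (ε : ℝ) : Prop :=
  ∃ t ∈ Ioo (0 : ℝ) 1, ∃ C > (0 : ℝ), ∀ r₁ ∈ Ioo (0 : ℝ) ε, ∀ r₂ ∈ Ioo (0 : ℝ) ε, r₁ ≤ r₂ →
    C * (r₁ ^ ((n : ℝ) + t - 1) * ρb r₁) ≤ r₂ ^ ((n : ℝ) + t - 1) * ρb r₂

variable {n : ℕ}

/-- Nonlocal gradient of a scalar field:
`D_ρ u(x) = ∫ ((u(x) - u(y))/|x-y|) ((x-y)/|x-y|) ρ(x-y) dy`. -/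
def nlGradS (ρ : Eu n → ℝ) (u : Eu n → ℝ) (x : Eu n) : Eu n :=
  ∫ y, ((u x - u y) * ρ (x - y) / ‖x - y‖ ^ 2) • (x - y)

/-- The (i,j) entry of the integrand of the nonlocal gradient of a vector field. -/
def nlGradMInt (ρ : Eu n → ℝ) (u : Eu n → Eu n) (x : Eu n) (i j : Fin n) : Eu n → ℝ :=
  fun y => (u x - u y) i * (x - y) j * ρ (x - y) / ‖x - y‖ ^ 2

/-- Nonlocal gradient of a vector field, as a matrix:
`D_ρ u(x) = ∫ ((u(x)-u(y))/|x-y|) ⊗ ((x-y)/|x-y|) ρ(x-y) dy`. -/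
def nlGradM (ρ : Eu n → ℝ) (u : Eu n → Eu n) (x : Eu n) : Matrix (Fin n) (Fin n) ℝ :=
  Matrix.of fun i j => ∫ y, nlGradMInt ρ u x i j y

/-- The integrand of the nonlocal divergence of a vector field. -/
def nlDivVInt (ρ : Eu n → ℝ) (u : Eu n → Eu n) (x : Eu n) : Eu n → ℝ :=
  fun y => ⟪u x - u y, x - y⟫_ℝ * ρ (x - y) / ‖x - y‖ ^ 2

/-- Nonlocal divergence of a vector field:
`div_ρ u(x) = ∫ ((u(x)-u(y))·(x-y)/|x-y|²) ρ(x-y) dy`. -/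
def nlDivV (ρ : Eu n → ℝ) (u : Eu n → Eu n) (x : Eu n) : ℝ :=
  ∫ y, nlDivVInt ρ u x y

/-- The i-th component of the integrand of the nonlocal divergence of a matrix field. -/
def nlDivMInt (ρ : Eu n → ℝ) (Φ : Eu n → Matrix (Fin n) (Fin n) ℝ) (x : Eu n) (i : Fin n) :
    Eu n → ℝ :=
  fun y => (∑ j, (Φ x i j - Φ y i j) * (x - y) j) * ρ (x - y) / ‖x - y‖ ^ 2

/-- Nonlocal divergence of a matrix field:
`div_ρ Φ(x) = ∫ ((Φ(x)-Φ(y))/|x-y|) ((x-y)/|x-y|) ρ(x-y) dy ∈ ℝ^n`. -/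
def nlDivM (ρ : Eu n → ℝ) (Φ : Eu n → Matrix (Fin n) (Fin n) ℝ) (x : Eu n) : Eu n :=
  (WithLp.equiv 2 (Fin n → ℝ)).symm fun i => ∫ y, nlDivMInt ρ Φ x i y

/-- Frobenius inner product `A : B = Σ_{ij} a_{ij} b_{ij}` of matrices. -/
def frobInner (A B : Matrix (Fin n) (Fin n) ℝ) : ℝ := ∑ i, ∑ j, A i j * B i j

/-- Symmetric part of a matrix, `M_sym = (M + Mᵀ)/2`. -/
def symPart (M : Matrix (Fin n) (Fin n) ℝ) : Matrix (Fin n) (Fin n) ℝ :=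
  (1 / 2 : ℝ) • (M + Mᵀ)

/-- The potential `Q_ρ(x) = ∫_{|x|}^∞ ρ̄(t)/t dt`. -/
def Qker (n : ℕ) (ρb : ℝ → ℝ) (x : Eu n) : ℝ := ∫ t in Ioi ‖x‖, ρb t / t

/-- Classical Jacobian matrix of a vector field, `(Du)_{ij} = ∂u_i/∂x_j`. -/
def jacobianM (u : Eu n → Eu n) (x : Eu n) : Matrix (Fin n) (Fin n) ℝ :=
  Matrix.of fun i j => fderiv ℝ (fun z => u z i) x (EuclideanSpace.single j 1)

/-- Rank-one matrix `a ⊗ b = (a_i b_j)`. -/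
def tensorP (a b : Eu n) : Matrix (Fin n) (Fin n) ℝ := Matrix.of fun i j => a i * b j

/-- Isotropic elasticity tensor `C[M] = 2μ M_sym + λ (tr M) I`. -/
def isoC (μ lam : ℝ) (M : Matrix (Fin n) (Fin n) ℝ) : Matrix (Fin n) (Fin n) ℝ :=
  (2 * μ) • symPart M + (lam * Matrix.trace M) • (1 : Matrix (Fin n) (Fin n) ℝ)

/-- Fourier transform `𝓕 f(ξ) = ∫ f(x) e^{-2πi x·ξ} dx` of a complex-valued function on ℝ^n. -/
def fInt (f : Eu n → ℂ) (ξ : Eu n) : ℂ :=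
  ∫ x, f x * Complex.exp (-(2 * Real.pi * (⟪x, ξ⟫_ℝ : ℝ) * Complex.I))

/-- The nonlocal Laplacian `(-Δ)_ρ v = -div_ρ (D_ρ v)` of a vector field. -/
def nlLap (ρ : Eu n → ℝ) (v : Eu n → Eu n) (x : Eu n) : Eu n :=
  -nlDivM ρ (fun z => nlGradM ρ v z) x

/-- The i-th component of the integrand of `K_{ρ,φ}(Φ)` from the nonlocal Leibniz rule. -/
def KtermInt (ρ : Eu n → ℝ) (φ : Eu n → ℝ) (Φ : Eu n → Matrix (Fin n) (Fin n) ℝ)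
    (x : Eu n) (i : Fin n) : Eu n → ℝ :=
  fun y => (φ x - φ y) * (∑ j, Φ y i j * (x - y) j) * ρ (x - y) / ‖x - y‖ ^ 2

/-- `K_{ρ,φ}(Φ)(x) = ∫ ((φ(x)-φ(y))/|x-y|) Φ(y) ((x-y)/|x-y|) ρ(x-y) dy`. -/
def Kterm (ρ : Eu n → ℝ) (φ : Eu n → ℝ) (Φ : Eu n → Matrix (Fin n) (Fin n) ℝ)
    (x : Eu n) : Eu n :=
  (WithLp.equiv 2 (Fin n → ℝ)).symm fun i => ∫ y, KtermInt ρ φ Φ x i y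

/-- Classical divergence of a vector field. -/
def divCl (w : Eu n → Eu n) (x : Eu n) : ℝ :=
  ∑ i, fderiv ℝ (fun z => w z i) x (EuclideanSpace.single i 1)

attribute [local instance] Matrix.frobeniusNormedAddCommGroup

section GaussianAverage

/-! ### The Gaussian average of a compactly supported field -/

/-- The density of the standard Gaussian measure on `ℝ^n`. -/
def gaussDensity (y : Eu n) : ℝ :=
  (∫ w : Eu n, Real.exp (-(1 / 2) * ‖w‖ ^ 2))⁻¹ * Real.exp (-(1 / 2) * ‖y‖ ^ 2)

lemma integral_exp_neg_mul_sq_norm_pos {b : ℝ} (hb : 0 < b) :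
    0 < ∫ w : Eu n, Real.exp (-b * ‖w‖ ^ 2) := by
  rw [GaussianFourier.integral_rexp_neg_mul_sq_norm hb]
  positivity

lemma integrable_exp_neg_mul_sq_norm {b : ℝ} (hb : 0 < b) :
    Integrable (fun w : Eu n => Real.exp (-b * ‖w‖ ^ 2)) := by
  by_contra h
  exact (integral_exp_neg_mul_sq_norm_pos (n := n) hb).ne' (integral_undef h)

lemma gaussDensity_nonneg (y : Eu n) : 0 ≤ gaussDensity y :=
  mul_nonneg (inv_nonneg.2 (integral_exp_neg_mul_sq_norm_pos (by norm_num)).le)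
    (Real.exp_pos _).le

lemma gaussDensity_le (y : Eu n) : gaussDensity y ≤ gaussDensity (0 : Eu n) := by
  unfold gaussDensity
  refine mul_le_mul_of_nonneg_left ?_
    (inv_nonneg.2 (integral_exp_neg_mul_sq_norm_pos (by norm_num)).le)
  rw [Real.exp_le_exp]
  simp

lemma continuous_gaussDensity : Continuous (gaussDensity : Eu n → ℝ) := by
  unfold gaussDensity
  fun_prop

lemma integral_gaussDensity : ∫ y : Eu n, gaussDensity y = 1 := by
  unfold gaussDensity
  rw [integral_const_mul]
  exact inv_mul_cancel₀ (integral_exp_neg_mul_sq_norm_pos (by norm_num)).ne'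

lemma hasFDerivAt_gaussDensity (y : Eu n) :
    HasFDerivAt gaussDensity (-(gaussDensity y) • innerSL ℝ y) y := by
  unfold gaussDensity
  convert! ((((hasStrictFDerivAt_norm_sq y).hasFDerivAt.const_mul (-(1 / 2) : ℝ)).exp).const_mul
    (∫ w : Eu n, Real.exp (-(1 / 2) * ‖w‖ ^ 2))⁻¹) using 1
  ext v
  simp
  ring

lemma integrable_pow_mul_gaussDensity (k : ℕ) :
    Integrable (fun y : Eu n => (1 + ‖y‖) ^ k * gaussDensity y) := by
  set c := (∫ w : Eu n, Real.exp (-(1 / 2) * ‖w‖ ^ 2))⁻¹ with hc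
  have hc0 : 0 ≤ c := inv_nonneg.2 (integral_exp_neg_mul_sq_norm_pos (by norm_num)).le
  refine ((integrable_exp_neg_mul_sq_norm (n := n) (b := 1 / 4) (by norm_num)).const_mul
    (k.factorial * Real.exp 2 * c)).mono' ?_ (.of_forall fun y => ?_)
  · exact ((by fun_prop : Continuous fun y : Eu n => (1 + ‖y‖) ^ k).mul
      continuous_gaussDensity).aestronglyMeasurable
  · rw [Real.norm_of_nonneg (mul_nonneg (by positivity) (gaussDensity_nonneg y))]
    have h1 : (1 + ‖y‖) ^ k ≤ k.factorial * Real.exp (1 + ‖y‖) := by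
      have := Real.pow_div_factorial_le_exp (1 + ‖y‖) (by positivity) k
      rwa [div_le_iff₀ (by positivity), mul_comm] at this
    have h2 : Real.exp (1 + ‖y‖) * Real.exp (-(1 / 2) * ‖y‖ ^ 2) ≤
        Real.exp 2 * Real.exp (-(1 / 4) * ‖y‖ ^ 2) := by
      rw [← Real.exp_add, ← Real.exp_add, Real.exp_le_exp]
      nlinarith [sq_nonneg (‖y‖ - 2)]
    calc (1 + ‖y‖) ^ k * gaussDensity y
        ≤ (k.factorial * Real.exp (1 + ‖y‖)) * gaussDensity y :=
          mul_le_mul_of_nonneg_right h1 (gaussDensity_nonneg y)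
      _ = k.factorial * c * (Real.exp (1 + ‖y‖) * Real.exp (-(1 / 2) * ‖y‖ ^ 2)) := by
          simp only [gaussDensity, ← hc]; ring
      _ ≤ k.factorial * c * (Real.exp 2 * Real.exp (-(1 / 4) * ‖y‖ ^ 2)) := by gcongr
      _ = _ := by ring

lemma integrable_gaussDensity : Integrable (gaussDensity : Eu n → ℝ) := by
  simpa using integrable_pow_mul_gaussDensity (n := n) 0

variable {F : Type*} [NormedAddCommGroup F] [NormedSpace ℝ F]

/-- The Gaussian average `∫ z(x + s y) dγ(y)`, that is, the heat flow at time `s² / 2`. -/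
def gaussAvg (s : ℝ) (z : Eu n → F) (x : Eu n) : F :=
  ∫ y, gaussDensity y • z (x + s • y)

lemma gaussAvg_zero [CompleteSpace F] (z : Eu n → F) (x : Eu n) : gaussAvg 0 z x = z x := by
  simp [gaussAvg, integral_smul_const, integral_gaussDensity]

lemma integrable_gaussDensity_smul {z : Eu n → F} (hz : Continuous z) {C : ℝ}
    (hC : ∀ x, ‖z x‖ ≤ C) (s : ℝ) (x : Eu n) :
    Integrable (fun y => gaussDensity y • z (x + s • y)) := by
  refine (integrable_gaussDensity.mul_const C).mono' ?_ (.of_forall fun y => ?_)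
  · exact (continuous_gaussDensity.smul (hz.comp (by fun_prop))).aestronglyMeasurable
  · rw [norm_smul, Real.norm_of_nonneg (gaussDensity_nonneg y)]
    exact mul_le_mul_of_nonneg_left (hC _) (gaussDensity_nonneg y)

lemma ContinuousLinearMap.gaussAvg_comp {G : Type*} [NormedAddCommGroup G] [NormedSpace ℝ G]
    [CompleteSpace F] [CompleteSpace G] (L : F →L[ℝ] G)
    {z : Eu n → F} (hz : Continuous z) (hzc : HasCompactSupport z) (s : ℝ) (x : Eu n) :
    gaussAvg s (fun x => L (z x)) x = L (gaussAvg s z x) := by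
  obtain ⟨C, hC⟩ := hz.bounded_above_of_compact_support hzc
  unfold gaussAvg
  rw [← L.integral_comp_comm (integrable_gaussDensity_smul hz hC s x)]
  simp

lemma hasFDerivAt_gaussAvg [CompleteSpace F] {z : Eu n → F} (hz : ContDiff ℝ 1 z)
    (hzc : HasCompactSupport z) (s : ℝ) (x : Eu n) :
    HasFDerivAt (gaussAvg s z) (gaussAvg s (fderiv ℝ z) x) x := by
  have hz' : Continuous (fderiv ℝ z) := hz.continuous_fderiv (by norm_num)
  obtain ⟨C, hC⟩ := hz.continuous.bounded_above_of_compact_support hzc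
  obtain ⟨C', hC'⟩ := hz'.bounded_above_of_compact_support (hzc.fderiv ℝ)
  refine hasFDerivAt_integral_of_dominated_of_fderiv_le (s := univ)
    (F' := fun x y => gaussDensity y • fderiv ℝ z (x + s • y))
    (bound := fun y => gaussDensity y * C') Filter.univ_mem
    (.of_forall fun x => (integrable_gaussDensity_smul hz.continuous hC s x).1)
    (integrable_gaussDensity_smul hz.continuous hC s x)
    (integrable_gaussDensity_smul hz' hC' s x).1
    (.of_forall fun y x _ => ?_) (integrable_gaussDensity.mul_const C')
    (.of_forall fun y x _ => ?_)
  · rw [norm_smul, Real.norm_of_nonneg (gaussDensity_nonneg y)]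
    exact mul_le_mul_of_nonneg_left (hC' _) (gaussDensity_nonneg y)
  · have h := (hz.differentiable (by norm_num) (x + s • y)).hasFDerivAt
    exact (h.comp x ((hasFDerivAt_id x).add_const (s • y))).const_smul (gaussDensity y)

lemma continuous_gaussAvg [CompleteSpace F] {z : Eu n → F} (hz : Continuous z)
    (hzc : HasCompactSupport z) (s : ℝ) : Continuous (gaussAvg s z) := by
  obtain ⟨C, hC⟩ := hz.bounded_above_of_compact_support hzc
  refine continuous_of_dominated (bound := fun y => gaussDensity y * C)
    (fun x => (integrable_gaussDensity_smul hz hC s x).1)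
    (fun x => .of_forall fun y => ?_) (integrable_gaussDensity.mul_const C)
    (.of_forall fun y => ?_)
  · rw [norm_smul, Real.norm_of_nonneg (gaussDensity_nonneg y)]
    exact mul_le_mul_of_nonneg_left (hC _) (gaussDensity_nonneg y)
  · exact continuous_const.smul (hz.comp (by fun_prop))

/-- The partial derivative in the `i`-th coordinate direction. -/
def partialD (i : Fin n) (z : Eu n → F) (x : Eu n) : F :=
  fderiv ℝ z x (EuclideanSpace.single i 1)

lemma ContDiff.partialD {z : Eu n → F} {k : ℕ} (hz : ContDiff ℝ (k + 1 : ℕ) z) (i : Fin n) :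
    ContDiff ℝ k (partialD i z) :=
  (hz.fderiv_right (m := k) (by norm_cast)).clm_apply contDiff_const

lemma HasCompactSupport.partialD {z : Eu n → F} (hz : HasCompactSupport z) (i : Fin n) :
    HasCompactSupport (partialD i z) :=
  hz.fderiv_apply ℝ (EuclideanSpace.single i 1)

lemma fderiv_apply_eq_sum_partialD (z : Eu n → F) (x v : Eu n) :
    fderiv ℝ z x v = ∑ i, v i • partialD i z x := by
  conv_lhs => rw [← (EuclideanSpace.basisFun (Fin n) ℝ).sum_repr v]
  simp [partialD]

lemma gaussAvg_partialD [CompleteSpace F] {z : Eu n → F} (hz : ContDiff ℝ 1 z)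
    (hzc : HasCompactSupport z) (i : Fin n) (s : ℝ) (x : Eu n) :
    gaussAvg s (partialD i z) x = gaussAvg s (fderiv ℝ z) x (EuclideanSpace.single i 1) :=
  (ContinuousLinearMap.apply ℝ F (EuclideanSpace.single i 1)).gaussAvg_comp
    (hz.continuous_fderiv (by norm_num)) (hzc.fderiv ℝ) s x

/-- Gaussian integration by parts. -/
lemma integral_coord_mul_gaussDensity_smul [CompleteSpace F] {z : Eu n → F} (hz : ContDiff ℝ 1 z)
    (hzc : HasCompactSupport z) (i : Fin n) (s : ℝ) (x : Eu n) :
    ∫ y, (y i * gaussDensity y) • z (x + s • y) = s • gaussAvg s (partialD i z) x := by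
  have hz' : Continuous (partialD i z) := (ContDiff.partialD (k := 0) (by simpa using hz) i).continuous
  obtain ⟨C, hC⟩ := hz.continuous.bounded_above_of_compact_support hzc
  obtain ⟨C', hC'⟩ := hz'.bounded_above_of_compact_support (hzc.partialD i)
  have hg : ∀ y, HasFDerivAt (fun y => z (x + s • y))
      ((fderiv ℝ z (x + s • y)).comp (s • ContinuousLinearMap.id ℝ (Eu n))) y := fun y =>
    (hz.differentiable (by norm_num) (x + s • y)).hasFDerivAt.comp y
      (((hasFDerivAt_id y).const_smul s).const_add x)
  have hi : ∀ y : Eu n, ⟪y, EuclideanSpace.single i (1 : ℝ)⟫_ℝ = y i := fun y => by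
    simp [EuclideanSpace.inner_single_right]
  have hcoord : Integrable fun y : Eu n => (y i * gaussDensity y) • z (x + s • y) := by
    refine ((integrable_pow_mul_gaussDensity 1).mul_const C).mono' ?_ (.of_forall fun y => ?_)
    · exact (((by fun_prop : Continuous fun y : Eu n => y i).mul continuous_gaussDensity).smul
        (hz.continuous.comp (by fun_prop))).aestronglyMeasurable
    · rw [norm_smul, norm_mul, Real.norm_of_nonneg (gaussDensity_nonneg y)]
      have h1 : ‖y i‖ ≤ (1 + ‖y‖) ^ 1 := by
        have := PiLp.norm_apply_le y i
        linarith
      have := gaussDensity_nonneg y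
      gcongr
      exact hC _
  have key := integral_bilinear_hasFDerivAt_right_eq_neg_left_of_integrable (μ := volume)
    (f := gaussDensity (n := n)) (f' := fun y => -(gaussDensity y) • innerSL ℝ y)
    (g := fun y => z (x + s • y))
    (g' := fun y => (fderiv ℝ z (x + s • y)).comp (s • ContinuousLinearMap.id ℝ (Eu n)))
    (v := EuclideanSpace.single i 1) (B := ContinuousLinearMap.lsmul ℝ ℝ) ?_ ?_ ?_
    (fun y _ => hasFDerivAt_gaussDensity y) (fun y _ => hg y)
  · rw [← integral_neg] at key
    convert! key.symm using 1
    · congr 1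
      ext y
      simp [hi, mul_comm]
    · unfold gaussAvg
      rw [← integral_smul]
      congr 1
      ext y
      simp [partialD, smul_comm s]
  · convert! hcoord.neg using 1
    ext y
    simp [hi, mul_comm]
  · convert! (integrable_gaussDensity_smul hz' hC' s x).smul s using 1
    ext y
    simp [partialD, smul_comm s]
  · exact integrable_gaussDensity_smul hz.continuous hC s x

lemma hasDerivAt_gaussAvg [CompleteSpace F] {z : Eu n → F} (hz : ContDiff ℝ 2 z)
    (hzc : HasCompactSupport z) (s : ℝ) (x : Eu n) :
    HasDerivAt (fun s => gaussAvg s z x)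
      (s • ∑ i, gaussAvg s (partialD i (partialD i z)) x) s := by
  have hz' : Continuous (fderiv ℝ z) := hz.continuous_fderiv (by norm_num)
  obtain ⟨C, hC⟩ := hz.continuous.bounded_above_of_compact_support hzc
  obtain ⟨C', hC'⟩ := hz'.bounded_above_of_compact_support (hzc.fderiv ℝ)
  have hmeas : ∀ s : ℝ,
      Continuous (fun y => gaussDensity y • fderiv ℝ z (x + s • y) y) := fun s =>
    continuous_gaussDensity.smul ((hz'.comp (by fun_prop)).clm_apply continuous_id)
  have hbd : ∀ (y : Eu n) (s : ℝ), ‖gaussDensity y • fderiv ℝ z (x + s • y) y‖ ≤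
      (1 + ‖y‖) ^ 1 * gaussDensity y * C' := fun y s => by
    rw [norm_smul, Real.norm_of_nonneg (gaussDensity_nonneg y)]
    have h1 : ‖fderiv ℝ z (x + s • y) y‖ ≤ C' * (1 + ‖y‖) :=
      ((fderiv ℝ z (x + s • y)).le_opNorm y).trans
        (mul_le_mul (hC' _) (by linarith) (norm_nonneg _) ((norm_nonneg _).trans (hC' x)))
    calc _ ≤ gaussDensity y * (C' * (1 + ‖y‖)) :=
          mul_le_mul_of_nonneg_left h1 (gaussDensity_nonneg y)
      _ = _ := by ring
  have key := (hasDerivAt_integral_of_dominated_loc_of_deriv_le (μ := volume) (s := univ) (x₀ := s)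
    (F := fun (s : ℝ) (y : Eu n) => gaussDensity y • z (x + s • y))
    (F' := fun s y => gaussDensity y • fderiv ℝ z (x + s • y) y)
    (bound := fun y => (1 + ‖y‖) ^ 1 * gaussDensity y * C') Filter.univ_mem
    (.of_forall fun s => (integrable_gaussDensity_smul hz.continuous hC s x).1)
    (integrable_gaussDensity_smul hz.continuous hC s x)
    (hmeas s).aestronglyMeasurable
    (.of_forall fun y s _ => hbd y s) ((integrable_pow_mul_gaussDensity 1).mul_const C')
    (.of_forall fun y s _ => ?_)).2
  · convert! key using 1
    have hsum : ∀ y : Eu n, gaussDensity y • fderiv ℝ z (x + s • y) y =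
        ∑ i, (y i * gaussDensity y) • partialD i z (x + s • y) := fun y => by
      rw [fderiv_apply_eq_sum_partialD, Finset.smul_sum]
      exact Finset.sum_congr rfl fun i _ => by rw [smul_smul, mul_comm]
    simp_rw [hsum]
    have hz1 : ∀ i, ContDiff ℝ 1 (partialD i z) := fun i =>
      ContDiff.partialD (k := 1) (by norm_cast at hz) i
    rw [integral_finsetSum]
    · rw [Finset.smul_sum]
      exact Finset.sum_congr rfl fun i _ =>
        (integral_coord_mul_gaussDensity_smul (hz1 i) (hzc.partialD i) i s x).symm
    · intro i _
      obtain ⟨D, hD⟩ := (hz1 i).continuous.bounded_above_of_compact_support (hzc.partialD i)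
      refine ((integrable_pow_mul_gaussDensity 1).mul_const D).mono' ?_ (.of_forall fun y => ?_)
      · exact (((by fun_prop : Continuous fun y : Eu n => y i).mul continuous_gaussDensity).smul
          ((hz1 i).continuous.comp (by fun_prop))).aestronglyMeasurable
      · rw [norm_smul, norm_mul, Real.norm_of_nonneg (gaussDensity_nonneg y)]
        have h1 : ‖y i‖ ≤ (1 + ‖y‖) ^ 1 := by
          have := PiLp.norm_apply_le y i
          linarith
        have := gaussDensity_nonneg y
        gcongr
        exact hD _
  · have h := (hz.differentiable (by norm_num) (x + s • y)).hasFDerivAt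
    have h2 : HasDerivAt (fun s : ℝ => x + s • y) y s := by
      simpa using ((hasDerivAt_id s).smul_const y).const_add x
    exact (h.comp_hasDerivAt s h2).const_smul (gaussDensity y)

/-- An integrable polynomially decaying weight on `ℝ^n`. -/
def decayWeight (x : Eu n) : ℝ := ((1 + ‖x‖) ^ (n + 1))⁻¹

lemma decayWeight_nonneg (x : Eu n) : 0 ≤ decayWeight x := by
  unfold decayWeight; positivity

lemma decayWeight_le_one (x : Eu n) : decayWeight x ≤ 1 :=
  inv_le_one_of_one_le₀ (one_le_pow₀ (by linarith [norm_nonneg x]))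

lemma integrable_decayWeight : Integrable (decayWeight : Eu n → ℝ) := by
  have := integrable_one_add_norm (E := Eu n) (μ := volume) (r := (n + 1 : ℕ)) (by simp)
  convert! this using 1
  ext x
  rw [decayWeight, Real.rpow_neg (by positivity), Real.rpow_natCast]

lemma decayWeight_add_le (x h : Eu n) :
    decayWeight (x + h) ≤ (1 + ‖h‖) ^ (n + 1) * decayWeight x := by
  unfold decayWeight
  have h1 : ‖x‖ ≤ ‖x + h‖ + ‖h‖ := by simpa using norm_sub_le (x + h) h
  rw [← div_eq_mul_inv, inv_eq_one_div, div_le_div_iff₀ (by positivity) (by positivity), one_mul,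
    ← mul_pow]
  gcongr
  nlinarith [norm_nonneg (x + h), norm_nonneg h]

lemma exists_norm_le_decayWeight {z : Eu n → F} (hz : Continuous z) (hzc : HasCompactSupport z) :
    ∃ C, 0 ≤ C ∧ ∀ x, ‖z x‖ ≤ C * decayWeight x := by
  have hcont : Continuous fun x => (1 + ‖x‖) ^ (n + 1) • z x := by fun_prop
  obtain ⟨C, hC⟩ := hcont.bounded_above_of_compact_support hzc.smul_left
  refine ⟨C, (norm_nonneg _).trans (hC 0), fun x => ?_⟩
  have := hC x
  rw [norm_smul, Real.norm_of_nonneg (by positivity)] at this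
  rw [decayWeight, ← div_eq_mul_inv, le_div_iff₀ (by positivity)]
  linarith

lemma exists_norm_gaussAvg_le_decayWeight {z : Eu n → F} (hz : Continuous z)
    (hzc : HasCompactSupport z) (T : ℝ) :
    ∃ C, 0 ≤ C ∧ ∀ s, |s| ≤ T → ∀ x, ‖gaussAvg s z x‖ ≤ C * decayWeight x := by
  obtain ⟨C, hC0, hC⟩ := exists_norm_le_decayWeight hz hzc
  set D : ℝ := ∫ y : Eu n, (1 + |T|) ^ (n + 1) * ((1 + ‖y‖) ^ (n + 1) * gaussDensity y)
  have hD : 0 ≤ D := integral_nonneg fun y =>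
    mul_nonneg (by positivity) (mul_nonneg (by positivity) (gaussDensity_nonneg y))
  refine ⟨D * C, by positivity, fun s hs x => ?_⟩
  rw [mul_assoc, ← integral_mul_const]
  refine norm_integral_le_of_norm_le
    (((integrable_pow_mul_gaussDensity (n + 1)).const_mul _).mul_const _) (.of_forall fun y => ?_)
  rw [norm_smul, Real.norm_of_nonneg (gaussDensity_nonneg y)]
  have h1 : 1 + ‖s • y‖ ≤ (1 + |T|) * (1 + ‖y‖) := by
    rw [norm_smul, Real.norm_eq_abs]
    have := hs.trans (le_abs_self T)
    nlinarith [norm_nonneg y, abs_nonneg T]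
  calc gaussDensity y * ‖z (x + s • y)‖
      ≤ gaussDensity y * (C * ((1 + ‖s • y‖) ^ (n + 1) * decayWeight x)) :=
        mul_le_mul_of_nonneg_left ((hC _).trans
          (mul_le_mul_of_nonneg_left (decayWeight_add_le _ _) hC0)) (gaussDensity_nonneg y)
    _ ≤ gaussDensity y * (C * (((1 + |T|) * (1 + ‖y‖)) ^ (n + 1) * decayWeight x)) := by
        have := gaussDensity_nonneg y
        have := decayWeight_nonneg x
        gcongr
    _ = _ := by rw [mul_pow]; ring

lemma norm_gaussAvg_le {z : Eu n → F} {C : ℝ} (hC : ∀ x, ‖z x‖ ≤ C) (s : ℝ) (x : Eu n) :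
    ‖gaussAvg s z x‖ ≤ C := by
  have : C = ∫ y : Eu n, gaussDensity y * C := by
    rw [integral_mul_const, integral_gaussDensity, one_mul]
  rw [this]
  refine norm_integral_le_of_norm_le (integrable_gaussDensity.mul_const C) (.of_forall fun y => ?_)
  rw [norm_smul, Real.norm_of_nonneg (gaussDensity_nonneg y)]
  exact mul_le_mul_of_nonneg_left (hC _) (gaussDensity_nonneg y)

lemma integral_norm_gaussAvg_le [CompleteSpace F] {z : Eu n → F} (hz : Continuous z)
    (hzc : HasCompactSupport z) (s : ℝ) : ∫ x, ‖gaussAvg s z x‖ ≤ ∫ x, ‖z x‖ := by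
  have hzi : Integrable fun x => ‖z x‖ := (hz.integrable_of_hasCompactSupport hzc).norm
  have hprod : Integrable (fun q : Eu n × Eu n => gaussDensity q.2 * ‖z (q.1 + s • q.2)‖)
      (volume.prod volume) := by
    have hcont : Continuous fun q : Eu n × Eu n => gaussDensity q.2 * ‖z (q.1 + s • q.2)‖ :=
      (continuous_gaussDensity.comp continuous_snd).mul
        (hz.comp (g := z) (f := fun q : Eu n × Eu n => q.1 + s • q.2) (by fun_prop)).norm
    rw [integrable_prod_iff' hcont.aestronglyMeasurable]
    refine ⟨.of_forall fun y => (hzi.comp_add_right (s • y)).const_mul (gaussDensity y), ?_⟩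
    have : (fun y : Eu n => ∫ x, ‖gaussDensity y * ‖z (x + s • y)‖‖) =
        fun y => gaussDensity y * ∫ x, ‖z x‖ := by
      ext y
      simp_rw [norm_mul, norm_norm, Real.norm_of_nonneg (gaussDensity_nonneg y)]
      rw [integral_const_mul, integral_add_right_eq_self (fun x => ‖z x‖)]
    rw [this]
    exact integrable_gaussDensity.mul_const _
  calc ∫ x, ‖gaussAvg s z x‖ ≤ ∫ x, ∫ y, gaussDensity y * ‖z (x + s • y)‖ := by
        refine integral_mono_of_nonneg (.of_forall fun x => norm_nonneg _)
          hprod.integral_prod_left (.of_forall fun x => ?_)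
        refine (norm_integral_le_integral_norm _).trans_eq ?_
        simp_rw [norm_smul, Real.norm_of_nonneg (gaussDensity_nonneg _)]
    _ = ∫ y, ∫ x, gaussDensity y * ‖z (x + s • y)‖ := integral_integral_swap hprod
    _ = ∫ y : Eu n, gaussDensity y * ∫ x, ‖z x‖ := by
        congr 1
        ext y
        rw [integral_const_mul, integral_add_right_eq_self (fun x => ‖z x‖)]
    _ = ∫ x, ‖z x‖ := by rw [integral_mul_const, integral_gaussDensity, one_mul]

lemma norm_gaussAvg_le_integral {z : Eu n → F} (hz : Continuous z)
    (hzc : HasCompactSupport z) {s : ℝ} (hs : 0 < s) (x : Eu n) :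
    ‖gaussAvg s z x‖ ≤ gaussDensity (0 : Eu n) * ((s ^ n)⁻¹ * ∫ x, ‖z x‖) := by
  have hzi : Integrable fun x => ‖z x‖ := (hz.integrable_of_hasCompactSupport hzc).norm
  have hi : Integrable fun y => ‖z (x + s • y)‖ :=
    (hzi.comp_add_left x).comp_smul hs.ne'
  have hinteg : ∫ y, ‖z (x + s • y)‖ = (s ^ n)⁻¹ * ∫ x, ‖z x‖ := by
    rw [Measure.integral_comp_smul volume (fun y => ‖z (x + y)‖) s,
      integral_add_left_eq_self (fun x => ‖z x‖)]
    simp [abs_of_pos hs]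
  rw [← hinteg, ← integral_const_mul]
  refine norm_integral_le_of_norm_le (hi.const_mul _) (.of_forall fun y => ?_)
  rw [norm_smul, Real.norm_of_nonneg (gaussDensity_nonneg y)]
  exact mul_le_mul_of_nonneg_right (gaussDensity_le y) (norm_nonneg _)

lemma integrable_norm_gaussAvg_sq [CompleteSpace F] {z : Eu n → F} (hz : Continuous z)
    (hzc : HasCompactSupport z) (s : ℝ) : Integrable fun x => ‖gaussAvg s z x‖ ^ 2 := by
  obtain ⟨C, hC0, hC⟩ := exists_norm_gaussAvg_le_decayWeight hz hzc |s|
  refine (integrable_decayWeight.const_mul (C ^ 2)).mono'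
    ((continuous_gaussAvg hz hzc s).norm.pow 2).aestronglyMeasurable (.of_forall fun x => ?_)
  rw [Real.norm_of_nonneg (by positivity)]
  calc ‖gaussAvg s z x‖ ^ 2 ≤ (C * decayWeight x) ^ 2 := by gcongr; exact hC s le_rfl x
    _ = C ^ 2 * (decayWeight x * decayWeight x) := by ring
    _ ≤ C ^ 2 * decayWeight x := by
      gcongr
      exact mul_le_of_le_one_left (decayWeight_nonneg x) (decayWeight_le_one x)

lemma integrable_norm_gaussAvg [CompleteSpace F] {z : Eu n → F} (hz : Continuous z)
    (hzc : HasCompactSupport z) (s : ℝ) : Integrable fun x => ‖gaussAvg s z x‖ := by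
  obtain ⟨C, hC0, hC⟩ := exists_norm_gaussAvg_le_decayWeight hz hzc |s|
  refine (integrable_decayWeight.const_mul C).mono'
    (continuous_gaussAvg hz hzc s).norm.aestronglyMeasurable (.of_forall fun x => ?_)
  rw [norm_norm]
  exact hC s le_rfl x

lemma tendsto_integral_norm_gaussAvg_sq [CompleteSpace F] (hn : 0 < n) {z : Eu n → F}
    (hz : Continuous z) (hzc : HasCompactSupport z) :
    Filter.Tendsto (fun s => ∫ x, ‖gaussAvg s z x‖ ^ 2) Filter.atTop (nhds 0) := by
  set I := ∫ x, ‖z x‖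
  set g := gaussDensity (0 : Eu n)
  have hlim : Filter.Tendsto (fun s : ℝ => g * ((s ^ n)⁻¹ * I) * I) Filter.atTop (nhds 0) := by
    have h1 : Filter.Tendsto (fun s : ℝ => (s ^ n)⁻¹) Filter.atTop (nhds 0) :=
      (Filter.tendsto_pow_atTop hn.ne').inv_tendsto_atTop
    simpa using ((h1.mul_const I).const_mul g).mul_const I
  refine squeeze_zero' (.of_forall fun s => integral_nonneg fun x => by positivity) ?_ hlim
  filter_upwards [Filter.eventually_gt_atTop 0] with s hs
  have hg : 0 ≤ g := gaussDensity_nonneg _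
  have hI : 0 ≤ I := integral_nonneg fun x => norm_nonneg _
  calc ∫ x, ‖gaussAvg s z x‖ ^ 2 ≤ ∫ x, g * ((s ^ n)⁻¹ * I) * ‖gaussAvg s z x‖ := by
        refine integral_mono (integrable_norm_gaussAvg_sq hz hzc s)
          ((integrable_norm_gaussAvg hz hzc s).const_mul _) fun x => ?_
        dsimp only
        rw [pow_two]
        exact mul_le_mul_of_nonneg_right (norm_gaussAvg_le_integral hz hzc hs x) (norm_nonneg _)
    _ ≤ g * ((s ^ n)⁻¹ * I) * I := by
        rw [integral_const_mul]
        exact mul_le_mul_of_nonneg_left (integral_norm_gaussAvg_le hz hzc s) (by positivity)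

end GaussianAverage

section HeatFlow

/-! ### Monotonicity of integral functionals along the heat flow -/

lemma exists_bounds_of_fderiv_zero_eq_zero {H : Type*} [NormedAddCommGroup H] [NormedSpace ℝ H]
    [FiniteDimensional ℝ H] {U : H → ℝ} (hU : ContDiff ℝ 2 U) (hU0 : U 0 = 0)
    (hdU0 : fderiv ℝ U 0 = 0) (R : ℝ) :
    ∃ L, 0 ≤ L ∧ ∀ w, ‖w‖ ≤ R → ‖fderiv ℝ (fderiv ℝ U) w‖ ≤ L ∧ ‖fderiv ℝ U w‖ ≤ L * ‖w‖ ∧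
      |U w| ≤ L * ‖w‖ ^ 2 := by
  have := FiniteDimensional.proper ℝ H
  have hU1 : ContDiff ℝ 1 (fderiv ℝ U) := hU.fderiv_right (by norm_num)
  have hU2 : Continuous (fderiv ℝ (fderiv ℝ U)) := hU1.continuous_fderiv (by norm_num)
  obtain ⟨L, hL⟩ := (isCompact_closedBall (0 : H) R).exists_bound_of_continuousOn
    (f := fderiv ℝ (fderiv ℝ U)) hU2.continuousOn
  have hd : ∀ w, ‖w‖ ≤ R → ‖fderiv ℝ U w‖ ≤ |L| * ‖w‖ := fun w hw => by
    have := (convex_closedBall (0 : H) R).norm_image_sub_le_of_norm_fderiv_le (𝕜 := ℝ)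
      (f := fderiv ℝ U) (C := |L|) (x := 0) (y := w)
      (fun x _ => hU1.differentiable (by norm_num) x)
      (fun x hx => (hL x hx).trans (le_abs_self L))
      (by simpa using (norm_nonneg w).trans hw) (by simpa using hw)
    simpa [hdU0] using this
  refine ⟨|L|, abs_nonneg L, fun w hw => ⟨(hL w (by simpa using hw)).trans (le_abs_self L),
    hd w hw, ?_⟩⟩
  have := (convex_closedBall (0 : H) ‖w‖).norm_image_sub_le_of_norm_fderiv_le (𝕜 := ℝ)
    (f := U) (C := |L| * ‖w‖) (x := 0) (y := w)
    (fun x _ => hU.differentiable (by norm_num) x)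
    (fun x hx => by
      have hx' : ‖x‖ ≤ ‖w‖ := by simpa using hx
      exact (hd x (hx'.trans hw)).trans (by gcongr))
    (by simp) (by simp)
  simpa [hU0, pow_two, mul_assoc] using this

variable {H : Type*} [NormedAddCommGroup H] [NormedSpace ℝ H] [FiniteDimensional ℝ H]

lemma integral_fderiv_comp_gaussAvg {U : H → ℝ} (hU : ContDiff ℝ 2 U) (hU0 : U 0 = 0)
    (hdU0 : fderiv ℝ U 0 = 0) {z : Eu n → H} (hz : ContDiff ℝ 2 z) (hzc : HasCompactSupport z)
    (i : Fin n) (s : ℝ) :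
    Integrable (fun x => fderiv ℝ U (gaussAvg s z x) (gaussAvg s (partialD i (partialD i z)) x)) ∧
    Integrable (fun x => fderiv ℝ (fderiv ℝ U) (gaussAvg s z x) (gaussAvg s (partialD i z) x)
      (gaussAvg s (partialD i z) x)) ∧
    ∫ x, fderiv ℝ U (gaussAvg s z x) (gaussAvg s (partialD i (partialD i z)) x) =
      -∫ x, fderiv ℝ (fderiv ℝ U) (gaussAvg s z x) (gaussAvg s (partialD i z) x)
        (gaussAvg s (partialD i z) x) := by
  have := FiniteDimensional.complete ℝ H
  have hz1 : ContDiff ℝ 1 (partialD i z) := ContDiff.partialD (k := 1) (by norm_cast at hz) i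
  have hz2 : ContDiff ℝ 0 (partialD i (partialD i z)) :=
    ContDiff.partialD (k := 0) (by simpa using hz1) i
  have hc1 := hzc.partialD i
  have hc2 := hc1.partialD i
  obtain ⟨R, hR⟩ := hz.continuous.bounded_above_of_compact_support hzc
  obtain ⟨L, hL0, hL⟩ := exists_bounds_of_fderiv_zero_eq_zero hU hU0 hdU0 R
  replace hL := fun x => hL _ (norm_gaussAvg_le hR s x)
  obtain ⟨C0, hC00, hC0⟩ := exists_norm_gaussAvg_le_decayWeight hz.continuous hzc |s|
  obtain ⟨C1, hC10, hC1⟩ := exists_norm_gaussAvg_le_decayWeight hz1.continuous hc1 |s|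
  obtain ⟨C2, hC20, hC2⟩ := exists_norm_gaussAvg_le_decayWeight hz2.continuous hc2 |s|
  replace hC0 := hC0 s le_rfl
  replace hC1 := hC1 s le_rfl
  replace hC2 := hC2 s le_rfl
  have hU1 : ContDiff ℝ 1 (fderiv ℝ U) := hU.fderiv_right (by norm_num)
  have hU2 : Continuous (fderiv ℝ (fderiv ℝ U)) := hU1.continuous_fderiv (by norm_num)
  have hZ := continuous_gaussAvg hz.continuous hzc s
  have hZ1 := continuous_gaussAvg hz1.continuous hc1 s
  have hZ2 := continuous_gaussAvg hz2.continuous hc2 s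
  have hdU : ∀ x, ‖fderiv ℝ U (gaussAvg s z x)‖ ≤ L * C0 := fun x => by
    refine (hL x).2.1.trans (mul_le_mul_of_nonneg_left ?_ hL0)
    exact (hC0 x).trans (mul_le_of_le_one_right hC00 (decayWeight_le_one x))
  have hint2 : Integrable (fun x =>
      fderiv ℝ U (gaussAvg s z x) (gaussAvg s (partialD i (partialD i z)) x)) := by
    refine (integrable_decayWeight.const_mul (L * C0 * C2)).mono'
      ((hU1.continuous.comp hZ).clm_apply hZ2).aestronglyMeasurable (.of_forall fun x => ?_)
    rw [mul_assoc (L * C0)]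
    exact (ContinuousLinearMap.le_opNorm _ _).trans
      (mul_le_mul (hdU x) (hC2 x) (norm_nonneg _) (by positivity))
  have hint1 : Integrable (fun x =>
      fderiv ℝ U (gaussAvg s z x) (gaussAvg s (partialD i z) x)) := by
    refine (integrable_decayWeight.const_mul (L * C0 * C1)).mono'
      ((hU1.continuous.comp hZ).clm_apply hZ1).aestronglyMeasurable (.of_forall fun x => ?_)
    rw [mul_assoc (L * C0)]
    exact (ContinuousLinearMap.le_opNorm _ _).trans
      (mul_le_mul (hdU x) (hC1 x) (norm_nonneg _) (by positivity))
  have hint3 : Integrable (fun x => fderiv ℝ (fderiv ℝ U) (gaussAvg s z x)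
      (gaussAvg s (partialD i z) x) (gaussAvg s (partialD i z) x)) := by
    refine (integrable_decayWeight.const_mul (L * C1 * C1)).mono'
      (((hU2.comp hZ).clm_apply hZ1).clm_apply hZ1).aestronglyMeasurable (.of_forall fun x => ?_)
    rw [mul_assoc (L * C1)]
    refine (ContinuousLinearMap.le_opNorm₂ _ _ _).trans
      (mul_le_mul (mul_le_mul (hL x).1 ?_ (norm_nonneg _) hL0) (hC1 x) (norm_nonneg _)
        (by positivity))
    exact (hC1 x).trans (mul_le_of_le_one_right hC10 (decayWeight_le_one x))
  refine ⟨hint2, hint3, ?_⟩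
  have hz1' : ContDiff ℝ 1 z := hz.of_le (by norm_num)
  have key := integral_bilinear_hasFDerivAt_right_eq_neg_left_of_integrable (μ := volume)
    (f := fun x => fderiv ℝ U (gaussAvg s z x))
    (f' := fun x => (fderiv ℝ (fderiv ℝ U) (gaussAvg s z x)).comp (gaussAvg s (fderiv ℝ z) x))
    (g := gaussAvg s (partialD i z)) (g' := fun x => gaussAvg s (fderiv ℝ (partialD i z)) x)
    (v := EuclideanSpace.single i 1) (B := ContinuousLinearMap.id ℝ (H →L[ℝ] ℝ)) ?_ ?_ ?_
    (fun x _ => (hU1.differentiable (by norm_num) _).hasFDerivAt.comp x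
      (hasFDerivAt_gaussAvg hz1' hzc s x))
    (fun x _ => hasFDerivAt_gaussAvg hz1 hc1 s x)
  · simpa [← gaussAvg_partialD hz1 hc1, ← gaussAvg_partialD hz1' hzc] using key
  · simpa [← gaussAvg_partialD hz1' hzc] using hint3
  · simpa [← gaussAvg_partialD hz1 hc1] using hint2
  · simpa using hint1

/-- If the Hessian of `U` is nonpositive along all spatial derivatives of the heat flow of `z`,
then `∫ U(z) ≤ 0`. -/
lemma integral_comp_nonpos_of_hessian_nonpos (hn : 0 < n) {U : H → ℝ} (hU : ContDiff ℝ 2 U)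
    (hU0 : U 0 = 0) (hdU0 : fderiv ℝ U 0 = 0) {z : Eu n → H} (hz : ContDiff ℝ 2 z)
    (hzc : HasCompactSupport z)
    (hess : ∀ s x, ∑ i, fderiv ℝ (fderiv ℝ U) (gaussAvg s z x) (gaussAvg s (partialD i z) x)
      (gaussAvg s (partialD i z) x) ≤ 0) :
    ∫ x, U (z x) ≤ 0 := by
  have := FiniteDimensional.complete ℝ H
  have hz2 : ∀ i, ContDiff ℝ 0 (partialD i (partialD i z)) := fun i =>
    ContDiff.partialD (k := 0) (by
      simpa using ContDiff.partialD (k := 1) (by norm_cast at hz) i) i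
  have hc2 := fun i => (hzc.partialD i).partialD i
  obtain ⟨R, hR⟩ := hz.continuous.bounded_above_of_compact_support hzc
  obtain ⟨L, hL0, hL⟩ := exists_bounds_of_fderiv_zero_eq_zero hU hU0 hdU0 R
  replace hL := fun s x => hL _ (norm_gaussAvg_le hR s x)
  have hZ := fun s => continuous_gaussAvg hz.continuous hzc s
  have hUZ : ∀ s, Integrable fun x => U (gaussAvg s z x) := fun s => by
    refine ((integrable_norm_gaussAvg_sq hz.continuous hzc s).const_mul L).mono'
      (hU.continuous.comp (hZ s)).aestronglyMeasurable (.of_forall fun x => (hL s x).2.2)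
  have hderiv : ∀ s, HasDerivAt (fun s => ∫ x, U (gaussAvg s z x))
      (∫ x, fderiv ℝ U (gaussAvg s z x) (s • ∑ i, gaussAvg s (partialD i (partialD i z)) x)) s := by
    intro s
    obtain ⟨C0, hC00, hC0⟩ := exists_norm_gaussAvg_le_decayWeight hz.continuous hzc (|s| + 1)
    choose C2 hC20 hC2 using fun i =>
      exists_norm_gaussAvg_le_decayWeight (hz2 i).continuous (hc2 i) (|s| + 1)
    have hsum : 0 ≤ ∑ i, C2 i := Finset.sum_nonneg fun i _ => hC20 i
    refine (hasDerivAt_integral_of_dominated_loc_of_deriv_le (μ := volume) (x₀ := s)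
      (s := ball s 1)
      (F' := fun s x => fderiv ℝ U (gaussAvg s z x)
        (s • ∑ i, gaussAvg s (partialD i (partialD i z)) x))
      (bound := fun x => L * C0 * ((|s| + 1) * ∑ i, C2 i) * decayWeight x)
      (ball_mem_nhds s one_pos) (.of_forall fun s => (hUZ s).1) (hUZ s) ?_
      (.of_forall fun x r hr => ?_) (integrable_decayWeight.const_mul _)
      (.of_forall fun x r _ => ?_)).2
    · refine Continuous.aestronglyMeasurable (Continuous.clm_apply
        ((hU.continuous_fderiv (by norm_num)).comp (hZ s)) ?_)
      exact (continuous_finsetSum _ fun i _ =>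
        continuous_gaussAvg (hz2 i).continuous (hc2 i) s).const_smul s
    · have hr' : |r| ≤ |s| + 1 := by
        have h1 : |r - s| < 1 := by simpa [Real.dist_eq] using hr
        have h2 := abs_add_le (r - s) s
        rw [sub_add_cancel] at h2
        linarith
      have h1 : ‖fderiv ℝ U (gaussAvg r z x)‖ ≤ L * C0 :=
        (hL r x).2.1.trans (mul_le_mul_of_nonneg_left ((hC0 r hr' x).trans
          (mul_le_of_le_one_right hC00 (decayWeight_le_one x))) hL0)
      have h2 : ‖r • ∑ i, gaussAvg r (partialD i (partialD i z)) x‖ ≤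
          (|s| + 1) * ((∑ i, C2 i) * decayWeight x) := by
        rw [norm_smul, Real.norm_eq_abs, Finset.sum_mul]
        exact mul_le_mul hr' (norm_sum_le_of_le _ fun i _ => hC2 i r hr' x) (norm_nonneg _)
          (by positivity)
      calc _ ≤ (L * C0) * ((|s| + 1) * ((∑ i, C2 i) * decayWeight x)) :=
            (ContinuousLinearMap.le_opNorm _ _).trans
              (mul_le_mul h1 h2 (norm_nonneg _) (by positivity))
        _ = _ := by ring
    · exact (hU.differentiable (by norm_num) _).hasFDerivAt.comp_hasDerivAt r
        (hasDerivAt_gaussAvg hz hzc r x)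
  have hmono : MonotoneOn (fun s => ∫ x, U (gaussAvg s z x)) (Ici 0) := by
    refine monotoneOn_of_deriv_nonneg (convex_Ici 0)
      (fun s _ => (hderiv s).continuousAt.continuousWithinAt)
      (fun s _ => (hderiv s).differentiableAt.differentiableWithinAt) fun s hs => ?_
    rw [interior_Ici] at hs
    rw [(hderiv s).deriv]
    have hparts := fun i => integral_fderiv_comp_gaussAvg hU hU0 hdU0 hz hzc i s
    simp only [map_smul, map_sum]
    rw [integral_smul, integral_finsetSum _ fun i _ => (hparts i).1,
      Finset.sum_congr rfl fun i _ => (hparts i).2.2, Finset.sum_neg_distrib,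
      ← integral_finsetSum _ fun i _ => (hparts i).2.1]
    exact smul_nonneg (le_of_lt hs) (neg_nonneg.2 (integral_nonpos fun x => hess s x))
  have hlim : Filter.Tendsto (fun s => ∫ x, U (gaussAvg s z x)) Filter.atTop (nhds 0) := by
    refine squeeze_zero_norm (fun s => ?_)
      (by simpa using (tendsto_integral_norm_gaussAvg_sq hn hz.continuous hzc).const_mul L)
    rw [← integral_const_mul]
    exact norm_integral_le_of_norm_le
      ((integrable_norm_gaussAvg_sq hz.continuous hzc s).const_mul L)
      (.of_forall fun x => (hL s x).2.2)
  have h0 : (∫ x, U (z x)) = ∫ x, U (gaussAvg 0 z x) := by simp [gaussAvg_zero]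
  rw [h0]
  refine ge_of_tendsto hlim ?_
  filter_upwards [Filter.eventually_ge_atTop 0] with s hs
  exact hmono self_mem_Ici hs hs

end HeatFlow

/-! ### Second derivatives along lines -/

/-- `f` is differentiable, its derivative at `0` is `a` and its second derivative at `0` is `b`. -/
def HasJetAtZero (f : ℝ → ℝ) (a b : ℝ) : Prop :=
  ∃ f' : ℝ → ℝ, (∀ r, HasDerivAt f (f' r) r) ∧ f' 0 = a ∧ HasDerivAt f' b 0

namespace HasJetAtZero

variable {f g : ℝ → ℝ} {a b a' b' : ℝ}

lemma sub (hf : HasJetAtZero f a b) (hg : HasJetAtZero g a' b') :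
    HasJetAtZero (fun r => f r - g r) (a - a') (b - b') := by
  obtain ⟨f', hf, rfl, hf2⟩ := hf
  obtain ⟨g', hg, rfl, hg2⟩ := hg
  exact ⟨fun r => f' r - g' r, fun r => (hf r).sub (hg r), rfl, hf2.sub hg2⟩

lemma add (hf : HasJetAtZero f a b) (hg : HasJetAtZero g a' b') :
    HasJetAtZero (fun r => f r + g r) (a + a') (b + b') := by
  obtain ⟨f', hf, rfl, hf2⟩ := hf
  obtain ⟨g', hg, rfl, hg2⟩ := hg
  exact ⟨fun r => f' r + g' r, fun r => (hf r).add (hg r), rfl, hf2.add hg2⟩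

lemma const (c : ℝ) : HasJetAtZero (fun _ => c) 0 0 :=
  ⟨fun _ => 0, fun r => hasDerivAt_const r c, rfl, hasDerivAt_const 0 0⟩

lemma const_mul (c : ℝ) (hf : HasJetAtZero f a b) :
    HasJetAtZero (fun r => c * f r) (c * a) (c * b) := by
  obtain ⟨f', hf, rfl, hf2⟩ := hf
  exact ⟨fun r => c * f' r, fun r => (hf r).const_mul c, rfl, hf2.const_mul c⟩

lemma mul (hf : HasJetAtZero f a b) (hg : HasJetAtZero g a' b') :
    HasJetAtZero (fun r => f r * g r) (a * g 0 + f 0 * a') (b * g 0 + 2 * a * a' + f 0 * b') := by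
  obtain ⟨f', hf, rfl, hf2⟩ := hf
  obtain ⟨g', hg, rfl, hg2⟩ := hg
  refine ⟨fun r => f' r * g r + f r * g' r, fun r => (hf r).mul (hg r), rfl, ?_⟩
  convert! (hf2.mul (hg 0)).add ((hf 0).mul hg2) using 1
  ring

lemma rpow_const (hf : HasJetAtZero f a b) (hpos : ∀ r, 0 < f r) (q : ℝ) :
    HasJetAtZero (fun r => f r ^ q) (a * q * f 0 ^ (q - 1))
      (b * q * f 0 ^ (q - 1) + a * q * (a * (q - 1) * f 0 ^ (q - 2))) := by
  obtain ⟨f', hf, rfl, hf2⟩ := hf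
  refine ⟨fun r => f' r * q * f r ^ (q - 1),
    fun r => (hf r).rpow_const (Or.inl (hpos r).ne'), rfl, ?_⟩
  convert! (hf2.mul_const q).mul ((hf 0).rpow_const (p := q - 1) (Or.inl (hpos 0).ne')) using 1
  ring_nf

end HasJetAtZero

section Jet

variable {H : Type*} [NormedAddCommGroup H]

lemma hasJetAtZero_norm_sq [InnerProductSpace ℝ H] (B : H →L[ℝ] H) (z d : H) :
    HasJetAtZero (fun r => ‖B (z + r • d)‖ ^ 2) (2 * ⟪B z, B d⟫_ℝ) (2 * ‖B d‖ ^ 2) := by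
  have hlin : ∀ r : ℝ, HasDerivAt (fun r => B (z + r • d)) (B d) r := fun r =>
    B.hasFDerivAt.comp_hasDerivAt r (by simpa using ((hasDerivAt_id r).smul_const d).const_add z)
  refine ⟨fun r => 2 * ⟪B (z + r • d), B d⟫_ℝ, fun r => (hlin r).norm_sq, by simp, ?_⟩
  have := ((hlin 0).inner ℝ (hasDerivAt_const (0 : ℝ) (B d))).const_mul 2
  simpa using this

lemma HasJetAtZero.fderiv_eq [NormedSpace ℝ H] {U : H → ℝ} (hU : ContDiff ℝ 2 U) {z d : H} {a b : ℝ}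
    (h : HasJetAtZero (fun r => U (z + r • d)) a b) :
    fderiv ℝ U z d = a ∧ fderiv ℝ (fderiv ℝ U) z d d = b := by
  obtain ⟨f', hf, rfl, hf2⟩ := h
  have hlin : ∀ r : ℝ, HasDerivAt (fun r : ℝ => z + r • d) d r := fun r => by
    simpa using ((hasDerivAt_id r).smul_const d).const_add z
  have h1 : f' = fun r => fderiv ℝ U (z + r • d) d := by
    ext r
    exact (hf r).unique
      ((hU.differentiable (by norm_num) _).hasFDerivAt.comp_hasDerivAt r (hlin r))
  have hU1 : ContDiff ℝ 1 (fderiv ℝ U) := hU.fderiv_right (by norm_num)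
  have h2 : HasDerivAt (fun r : ℝ => fderiv ℝ U (z + r • d) d)
      (fderiv ℝ (fderiv ℝ U) (z + (0 : ℝ) • d) d d) 0 := by
    have := ((hU1.differentiable (by norm_num) _).hasFDerivAt.comp_hasDerivAt (0 : ℝ) (hlin 0))
    simpa using this.clm_apply (hasDerivAt_const (0 : ℝ) d)
  rw [h1] at hf2 ⊢
  simp only [zero_smul, add_zero] at h2 ⊢
  exact ⟨trivial, h2.unique hf2⟩

end Jet

/-! ### The two auxiliary functions -/

section Bellman

variable {H : Type*} [NormedAddCommGroup H] [InnerProductSpace ℝ H]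

/-- The function whose integral controls `‖z‖^p - K ‖S z‖^p` for `p = 2 a ≤ 2`, regularized by
`e`. -/
def subquadraticAux (S : H →L[ℝ] H) (a K e : ℝ) (z : H) : ℝ :=
  (‖z‖ ^ 2 + e ^ 2) ^ a - K * (‖S z‖ ^ 2 + e ^ 2) ^ a - ((e ^ 2) ^ a - K * (e ^ 2) ^ a)

/-- The function whose integral controls `‖z‖^p - C ‖S z‖^p` for `p = 2 t + 2 > 2`, regularized by
`e`. -/
def superquadraticAux (S A : H →L[ℝ] H) (t m K e : ℝ) (z : H) : ℝ :=
  (m ^ 2 * ‖S z‖ ^ 2 + ‖A z‖ ^ 2 + e ^ 2) ^ (t + 1) -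
    K * ((m ^ 2 * ‖S z‖ ^ 2 + ‖A z‖ ^ 2 + e ^ 2) ^ t * ‖S z‖ ^ 2) - (e ^ 2) ^ (t + 1)

lemma contDiff_subquadraticAux (S : H →L[ℝ] H) (a K : ℝ) {e : ℝ} (he : e ≠ 0) :
    ContDiff ℝ 2 (subquadraticAux S a K e) := by
  have he2 : 0 < e ^ 2 := by positivity
  unfold subquadraticAux
  refine ((((contDiff_norm_sq ℝ).add contDiff_const).rpow_const_of_ne fun z => ?_).sub
    (contDiff_const.mul (((S.contDiff.norm_sq ℝ).add contDiff_const).rpow_const_of_ne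
      fun z => ?_))).sub contDiff_const <;> positivity

lemma contDiff_superquadraticAux (S A : H →L[ℝ] H) (t m K : ℝ) {e : ℝ} (he : e ≠ 0) :
    ContDiff ℝ 2 (superquadraticAux S A t m K e) := by
  have he2 : 0 < e ^ 2 := by positivity
  have hbase : ContDiff ℝ 2 fun z => m ^ 2 * ‖S z‖ ^ 2 + ‖A z‖ ^ 2 + e ^ 2 :=
    ((contDiff_const.mul (S.contDiff.norm_sq ℝ)).add (A.contDiff.norm_sq ℝ)).add contDiff_const
  unfold superquadraticAux
  refine ((hbase.rpow_const_of_ne fun z => ?_).sub (contDiff_const.mul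
    ((hbase.rpow_const_of_ne fun z => ?_).mul (S.contDiff.norm_sq ℝ)))).sub contDiff_const <;>
    positivity

lemma fderiv_subquadraticAux_zero (S : H →L[ℝ] H) (a K : ℝ) {e : ℝ} (he : e ≠ 0) :
    fderiv ℝ (subquadraticAux S a K e) 0 = 0 := by
  have he2 : 0 < e ^ 2 := by positivity
  ext d
  have h1 := ((hasJetAtZero_norm_sq (ContinuousLinearMap.id ℝ H) 0 d).add
    (HasJetAtZero.const (e ^ 2))).rpow_const (fun r => by positivity) a
  have h2 := ((hasJetAtZero_norm_sq S 0 d).add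
    (HasJetAtZero.const (e ^ 2))).rpow_const (fun r => by positivity) a
  have := (HasJetAtZero.fderiv_eq (contDiff_subquadraticAux S a K he)
    ((h1.sub (h2.const_mul K)).sub (HasJetAtZero.const ((e ^ 2) ^ a - K * (e ^ 2) ^ a)))).1
  simpa using this

lemma fderiv_superquadraticAux_zero (S A : H →L[ℝ] H) (t m K : ℝ) {e : ℝ} (he : e ≠ 0) :
    fderiv ℝ (superquadraticAux S A t m K e) 0 = 0 := by
  have he2 : 0 < e ^ 2 := by positivity
  ext d
  have hS := hasJetAtZero_norm_sq S 0 d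
  have h := ((hS.const_mul (m ^ 2)).add (hasJetAtZero_norm_sq A 0 d)).add
    (HasJetAtZero.const (e ^ 2))
  have h1 := h.rpow_const (fun r => by positivity) (t + 1)
  have h2 := (h.rpow_const (fun r => by positivity) t).mul hS
  have := (HasJetAtZero.fderiv_eq (contDiff_superquadraticAux S A t m K he)
    ((h1.sub (h2.const_mul K)).sub (HasJetAtZero.const ((e ^ 2) ^ (t + 1))))).1
  simpa using this

lemma sum_hessian_subquadraticAux_nonpos {ι : Type*} [Fintype ι] {S A : H →L[ℝ] H}
    (hSA : ∀ z, ‖S z‖ ^ 2 + ‖A z‖ ^ 2 = ‖z‖ ^ 2) {a : ℝ} (ha : 1 / 2 < a) (ha1 : a ≤ 1) {e : ℝ}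
    (he : e ≠ 0) (z : H) (d : ι → H) (hd : ∑ i, ‖A (d i)‖ ^ 2 ≤ 4 * ∑ i, ‖S (d i)‖ ^ 2) :
    ∑ i, fderiv ℝ (fderiv ℝ (subquadraticAux S a (5 / (2 * a - 1)) e)) z (d i) (d i) ≤ 0 := by
  have he2 : 0 < e ^ 2 := by positivity
  have ha2 : 0 < 2 * a - 1 := by linarith
  set K := 5 / (2 * a - 1) with hK
  have hK0 : 0 < K := by positivity
  have hKa : K * (2 * a - 1) = 5 := by rw [hK]; field_simp
  set μ := ‖S z‖ ^ 2 + e ^ 2 with hμ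
  have hμ0 : 0 < μ := by positivity
  have hμτ : μ ≤ ‖z‖ ^ 2 + e ^ 2 := by nlinarith [hSA z, sq_nonneg ‖A z‖]
  have hpoint : ∀ i, fderiv ℝ (fderiv ℝ (subquadraticAux S a K e)) z (d i) (d i) ≤
      2 * a * μ ^ (a - 1) * (‖d i‖ ^ 2 - 5 * ‖S (d i)‖ ^ 2) := by
    intro i
    have h1 := ((hasJetAtZero_norm_sq (ContinuousLinearMap.id ℝ H) z (d i)).add
      (HasJetAtZero.const (e ^ 2))).rpow_const (fun r => by positivity) a
    have h2 := ((hasJetAtZero_norm_sq S z (d i)).add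
      (HasJetAtZero.const (e ^ 2))).rpow_const (fun r => by positivity) a
    rw [(HasJetAtZero.fderiv_eq (contDiff_subquadraticAux S a K he)
      ((h1.sub (h2.const_mul K)).sub (HasJetAtZero.const ((e ^ 2) ^ a - K * (e ^ 2) ^ a)))).2]
    simp only [zero_smul, add_zero, ContinuousLinearMap.id_apply, sub_zero, ← hμ]
    set τ := ‖z‖ ^ 2 + e ^ 2 with hτ
    have hτ0 : 0 < τ := by positivity
    have e1 : τ ^ (a - 1) ≤ μ ^ (a - 1) :=
      Real.rpow_le_rpow_of_nonpos hμ0 hμτ (by linarith)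
    have e2 : μ ^ (a - 1) = μ * μ ^ (a - 2) := by
      rw [show a - 1 = 1 + (a - 2) by ring, Real.rpow_add hμ0, Real.rpow_one]
    have e3 : ⟪S z, S (d i)⟫_ℝ ^ 2 ≤ μ * ‖S (d i)‖ ^ 2 := by
      have h := abs_real_inner_le_norm (S z) (S (d i))
      have h' := sq_le_sq' (by linarith [neg_abs_le ⟪S z, S (d i)⟫_ℝ])
        ((le_abs_self _).trans h)
      nlinarith [sq_nonneg ‖S (d i)‖]
    have e4 : 0 ≤ τ ^ (a - 2) := by positivity
    have e5 : 0 ≤ μ ^ (a - 2) := by positivity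
    have f1 : 2 * ‖d i‖ ^ 2 * a * τ ^ (a - 1) +
        2 * ⟪z, d i⟫_ℝ * a * (2 * ⟪z, d i⟫_ℝ * (a - 1) * τ ^ (a - 2)) ≤
        2 * a * μ ^ (a - 1) * ‖d i‖ ^ 2 := by
      have g1 : 0 ≤ (1 - a) * (a * τ ^ (a - 2) * ⟪z, d i⟫_ℝ ^ 2) :=
        mul_nonneg (by linarith) (by positivity)
      have g2 : (a * ‖d i‖ ^ 2) * τ ^ (a - 1) ≤ (a * ‖d i‖ ^ 2) * μ ^ (a - 1) := by gcongr
      linarith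
    have f2 : 2 * a * (2 * a - 1) * μ ^ (a - 1) * ‖S (d i)‖ ^ 2 ≤
        2 * ‖S (d i)‖ ^ 2 * a * μ ^ (a - 1) +
        2 * ⟪S z, S (d i)⟫_ℝ * a * (2 * ⟪S z, S (d i)⟫_ℝ * (a - 1) * μ ^ (a - 2)) := by
      have g1 : ((1 - a) * (a * μ ^ (a - 2))) * ⟪S z, S (d i)⟫_ℝ ^ 2 ≤
          ((1 - a) * (a * μ ^ (a - 2))) * (μ * ‖S (d i)‖ ^ 2) :=
        mul_le_mul_of_nonneg_left e3 (mul_nonneg (by linarith) (by positivity))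
      rw [e2]
      linarith
    have f3 := mul_le_mul_of_nonneg_left f2 hK0.le
    have f4 : K * (2 * a * (2 * a - 1) * μ ^ (a - 1) * ‖S (d i)‖ ^ 2) =
        5 * (2 * a * μ ^ (a - 1) * ‖S (d i)‖ ^ 2) := by rw [← hKa]; ring
    linarith
  refine (Finset.sum_le_sum fun i _ => hpoint i).trans ?_
  rw [← Finset.mul_sum]
  refine mul_nonpos_of_nonneg_of_nonpos (by positivity) ?_
  rw [Finset.sum_sub_distrib, ← Finset.mul_sum]
  have : ∑ i, ‖d i‖ ^ 2 = ∑ i, ‖S (d i)‖ ^ 2 + ∑ i, ‖A (d i)‖ ^ 2 := by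
    rw [← Finset.sum_add_distrib]
    exact Finset.sum_congr rfl fun i _ => (hSA _).symm
  linarith

set_option maxHeartbeats 400000 in
/-- Pointwise bound for the second derivative of `σ^(t+1) - K σ^t X²` along a line, where
`σ = m² X² + Y² + e²`. -/
lemma superquadratic_hessian_le {t m K σ X Y P Q x y : ℝ} (ht : 0 < t) (hm : 4 ≤ m)
    (hmt : 20 * t ≤ m) (hK : 0 ≤ K) (hσ : 0 < σ) (hX : 0 ≤ X) (hY : 0 ≤ Y) (hP : 0 ≤ P)
    (hQ : 0 ≤ Q) (hx : |x| ≤ X * P) (hy : |y| ≤ Y * Q) (hXY : m ^ 2 * X ^ 2 + Y ^ 2 ≤ σ) :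
    (2 * (m ^ 2 * P ^ 2 + Q ^ 2)) * (t + 1) * σ ^ (t + 1 - 1) +
        (2 * (m ^ 2 * x + y)) * (t + 1) * ((2 * (m ^ 2 * x + y)) * (t + 1 - 1) * σ ^ (t + 1 - 2)) -
      K * (((2 * (m ^ 2 * P ^ 2 + Q ^ 2)) * t * σ ^ (t - 1) +
        (2 * (m ^ 2 * x + y)) * t * ((2 * (m ^ 2 * x + y)) * (t - 1) * σ ^ (t - 2))) * X ^ 2 +
        2 * ((2 * (m ^ 2 * x + y)) * t * σ ^ (t - 1)) * (2 * x) + σ ^ t * (2 * P ^ 2)) ≤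
    σ ^ t * ((t + 1) * (2 * t + 1) * (2 * (m ^ 2 * P ^ 2 + Q ^ 2)) -
      K * (33 / 20 * P ^ 2 - 3 / 25 * Q ^ 2)) := by
  have hm0 : 0 < m := by linarith
  have hT : 0 < σ ^ t := by positivity
  have e1 : σ ^ (t - 1) = σ ^ t / σ := by rw [Real.rpow_sub hσ, Real.rpow_one]
  have e2 : σ ^ (t - 2) = σ ^ t / σ ^ 2 := by
    rw [Real.rpow_sub hσ]; norm_num
  rw [show t + 1 - 2 = t - 1 by ring, show t + 1 - 1 = t by ring, e1, e2]
  set T := σ ^ t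
  have hx2 : x ^ 2 ≤ X ^ 2 * P ^ 2 := by
    rw [← mul_pow, ← sq_abs x]; gcongr
  have hxy : |x * y| ≤ (X * P) * (Y * Q) := by
    rw [abs_mul]; gcongr
  have hy2 : y ^ 2 ≤ Y ^ 2 * Q ^ 2 := by
    rw [← mul_pow, ← sq_abs y]; gcongr
  have hs1 : (m ^ 2 * x + y) ^ 2 ≤ σ * (m ^ 2 * P ^ 2 + Q ^ 2) := by
    have h1 : (m ^ 2 * x + y) ^ 2 ≤ (m ^ 2 * X ^ 2 + Y ^ 2) * (m ^ 2 * P ^ 2 + Q ^ 2) := by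
      have h2 := le_abs_self (x * y)
      have h3 : m ^ 4 * x ^ 2 ≤ m ^ 4 * (X ^ 2 * P ^ 2) := by gcongr
      have h4 : m ^ 2 * (x * y) ≤ m ^ 2 * ((X * P) * (Y * Q)) :=
        mul_le_mul_of_nonneg_left (h2.trans hxy) (sq_nonneg m)
      linarith [mul_nonneg (sq_nonneg m) (sq_nonneg (X * Q - Y * P))]
    exact h1.trans (by gcongr)
  set w := m ^ 2 * x + y
  set v := m ^ 2 * P ^ 2 + Q ^ 2
  have hv : 0 ≤ v := by positivity
  have hw : w ^ 2 / σ ≤ v := by rw [div_le_iff₀ hσ]; linarith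
  have c1 : 2 * v * (t + 1) * T + 2 * w * (t + 1) * (2 * w * t * (T / σ)) ≤
      T * ((t + 1) * (2 * t + 1) * (2 * v)) := by
    have : T * (t * (t + 1)) * (w ^ 2 / σ) ≤ T * (t * (t + 1)) * v := by gcongr
    calc _ = 2 * v * (t + 1) * T + 4 * (T * (t * (t + 1)) * (w ^ 2 / σ)) := by ring
      _ ≤ _ := by linarith
  have hXσ : X ^ 2 / σ ≤ 1 / m ^ 2 := by
    rw [div_le_div_iff₀ hσ (by positivity)]; nlinarith [sq_nonneg Y]
  have c2 : -(1 / 4) * v / m ^ 2 ≤ (2 * v * t + 4 * (t * (t - 1)) * (w ^ 2 / σ)) * (X ^ 2 / σ) := by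
    have hb : -(1 / 4) * v ≤ 2 * v * t + 4 * (t * (t - 1)) * (w ^ 2 / σ) := by
      rcases le_or_gt 1 t with h | h
      · have : 0 ≤ t * (t - 1) * (w ^ 2 / σ) :=
          mul_nonneg (mul_nonneg ht.le (by linarith)) (by positivity)
        linarith [mul_nonneg hv ht.le]
      · have h1 : (t * (1 - t)) * (w ^ 2 / σ) ≤ (t * (1 - t)) * v :=
          mul_le_mul_of_nonneg_left hw (mul_nonneg ht.le (by linarith))
        linarith [mul_nonneg hv (sq_nonneg (t - 1 / 4))]
    have hq : 0 ≤ X ^ 2 / σ := by positivity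
    calc -(1 / 4) * v / m ^ 2 = -(1 / 4) * v * (1 / m ^ 2) := by ring
      _ ≤ -(1 / 4) * v * (X ^ 2 / σ) := by linarith [mul_le_mul_of_nonneg_left hXσ hv]
      _ ≤ _ := mul_le_mul_of_nonneg_right hb hq
  have c3 : -(1 / 10) * (P ^ 2 + Q ^ 2) ≤ 8 * t * (w * x) / σ := by
    rw [le_div_iff₀ hσ]
    have h1 : -((X * P) * (Y * Q)) ≤ w * x := by
      have := neg_abs_le (x * y)
      have : w * x = m ^ 2 * x ^ 2 + x * y := by ring
      linarith [mul_nonneg (sq_nonneg m) (sq_nonneg x)]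
    have h2 : 2 * m * (X * Y) ≤ σ := by linarith [sq_nonneg (m * X - Y)]
    have h3 : 40 * t * (X * Y) ≤ σ := by
      linarith [mul_le_mul_of_nonneg_right hmt (mul_nonneg hX hY)]
    have h4 : 8 * t * ((X * P) * (Y * Q)) ≤ σ / 5 * (P * Q) := by
      linarith [mul_le_mul_of_nonneg_right h3 (mul_nonneg hP hQ)]
    have h5 : σ * (P * Q) ≤ σ * ((P ^ 2 + Q ^ 2) / 2) := by
      gcongr; linarith [sq_nonneg (P - Q)]
    have h6 : -(8 * t * ((X * P) * (Y * Q))) ≤ 8 * t * (w * x) := by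
      linarith [mul_le_mul_of_nonneg_left h1 ht.le]
    linarith
  have c4 : v / m ^ 2 ≤ P ^ 2 + Q ^ 2 / 16 := by
    rw [div_le_iff₀ (by positivity)]
    have h1 : 16 ≤ m ^ 2 := by nlinarith
    have : v = m ^ 2 * P ^ 2 + Q ^ 2 := rfl
    nlinarith [mul_le_mul_of_nonneg_right h1 (sq_nonneg Q)]
  have c5 : T * (33 / 20 * P ^ 2 - 3 / 25 * Q ^ 2) ≤
      (2 * v * t * (T / σ) + 2 * w * t * (2 * w * (t - 1) * (T / σ ^ 2))) * X ^ 2 +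
        2 * (2 * w * t * (T / σ)) * (2 * x) + T * (2 * P ^ 2) := by
    calc T * (33 / 20 * P ^ 2 - 3 / 25 * Q ^ 2) ≤
        T * ((2 * v * t + 4 * (t * (t - 1)) * (w ^ 2 / σ)) * (X ^ 2 / σ) +
          8 * t * (w * x) / σ + 2 * P ^ 2) := by
          gcongr
          have : -(1 / 4) * v / m ^ 2 = -(1 / 4) * (v / m ^ 2) := by ring
          linarith [sq_nonneg Q]
      _ = _ := by ring
  have c6 := mul_le_mul_of_nonneg_left c5 hK
  linarith

lemma sum_hessian_superquadraticAux_nonpos {ι : Type*} [Fintype ι] {S A : H →L[ℝ] H}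
    {t m K : ℝ} (ht : 0 < t) (hm : 4 ≤ m) (hmt : 20 * t ≤ m)
    (hK : (t + 1) * (2 * t + 1) * (2 * (m ^ 2 + 4)) ≤ K) {e : ℝ} (he : e ≠ 0) (z : H) (d : ι → H)
    (hd : ∑ i, ‖A (d i)‖ ^ 2 ≤ 4 * ∑ i, ‖S (d i)‖ ^ 2) :
    ∑ i, fderiv ℝ (fderiv ℝ (superquadraticAux S A t m K e)) z (d i) (d i) ≤ 0 := by
  have he2 : 0 < e ^ 2 := by positivity
  have hK0 : 0 ≤ K := le_trans (by positivity) hK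
  set σ := m ^ 2 * ‖S z‖ ^ 2 + ‖A z‖ ^ 2 + e ^ 2 with hσ
  have hσ0 : 0 < σ := by positivity
  have hpoint : ∀ i, fderiv ℝ (fderiv ℝ (superquadraticAux S A t m K e)) z (d i) (d i) ≤
      σ ^ t * ((t + 1) * (2 * t + 1) * (2 * (m ^ 2 * ‖S (d i)‖ ^ 2 + ‖A (d i)‖ ^ 2)) -
        K * (33 / 20 * ‖S (d i)‖ ^ 2 - 3 / 25 * ‖A (d i)‖ ^ 2)) := by
    intro i
    have hS := hasJetAtZero_norm_sq S z (d i)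
    have h := ((hS.const_mul (m ^ 2)).add (hasJetAtZero_norm_sq A z (d i))).add
      (HasJetAtZero.const (e ^ 2))
    have h1 := h.rpow_const (fun r => by positivity) (t + 1)
    have h2 := (h.rpow_const (fun r => by positivity) t).mul hS
    rw [(HasJetAtZero.fderiv_eq (contDiff_superquadraticAux S A t m K he)
      ((h1.sub (h2.const_mul K)).sub (HasJetAtZero.const ((e ^ 2) ^ (t + 1))))).2]
    refine le_trans (le_of_eq ?_) (superquadratic_hessian_le ht hm hmt hK0 hσ0 (norm_nonneg (S z))
      (norm_nonneg (A z)) (norm_nonneg (S (d i))) (norm_nonneg (A (d i)))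
      (abs_real_inner_le_norm (S z) (S (d i))) (abs_real_inner_le_norm (A z) (A (d i)))
      (by rw [hσ]; linarith))
    simp only [zero_smul, add_zero, sub_zero, ← hσ]
    ring
  refine (Finset.sum_le_sum fun i _ => hpoint i).trans ?_
  rw [← Finset.mul_sum]
  refine mul_nonpos_of_nonneg_of_nonpos (by positivity) ?_
  simp only [mul_sub, mul_add, Finset.sum_sub_distrib, Finset.sum_add_distrib, ← Finset.mul_sum]
  set p := ∑ i, ‖S (d i)‖ ^ 2
  set q := ∑ i, ‖A (d i)‖ ^ 2
  have hp : 0 ≤ p := Finset.sum_nonneg fun i _ => by positivity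
  have h1 : ((t + 1) * (2 * t + 1)) * (2 * q) ≤ ((t + 1) * (2 * t + 1)) * (2 * (4 * p)) := by
    gcongr
  have h2 := mul_le_mul_of_nonneg_right hK hp
  have h3 : K * (3 / 25 * q) ≤ K * (3 / 25 * (4 * p)) := by gcongr
  nlinarith [mul_nonneg hK0 hp]

end Bellman

/-! ### The `L^p` inequality for fields with controlled gradients -/

section Korn

variable {H : Type*} [NormedAddCommGroup H]

lemma integral_comp_nonpos_of_forall_ne_zero {z : Eu n → H} (hz : Continuous z)
    (hzc : HasCompactSupport z) {V : ℝ → H → ℝ} (hV : Continuous V.uncurry) (hV0 : ∀ e, V e 0 = 0)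
    (h : ∀ e, e ≠ 0 → ∫ x, V e (z x) ≤ 0) : ∫ x, V 0 (z x) ≤ 0 := by
  have hset : ∀ e, ∫ x in tsupport z, V e (z x) = ∫ x, V e (z x) := fun e =>
    setIntegral_eq_integral_of_forall_compl_eq_zero fun x hx => by
      rw [image_eq_zero_of_notMem_tsupport hx, hV0]
  have hcont : Continuous fun e => ∫ x, V e (z x) := by
    simp_rw [← hset]
    exact continuous_parametric_integral_of_continuous (f := fun e x => V e (z x))
      (hV.comp (continuous_fst.prodMk (hz.comp continuous_snd))) hzc
  have hlim : Filter.Tendsto (fun e => ∫ x, V e (z x)) (nhdsWithin 0 {0}ᶜ)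
      (nhds (∫ x, V 0 (z x))) := (hcont.tendsto 0).mono_left nhdsWithin_le_nhds
  exact le_of_tendsto hlim (Filter.eventually_of_mem self_mem_nhdsWithin h)

variable [InnerProductSpace ℝ H]

lemma norm_sq_rpow_le_superquadraticAux {S A : H →L[ℝ] H}
    (hSA : ∀ z, ‖S z‖ ^ 2 + ‖A z‖ ^ 2 = ‖z‖ ^ 2) {t m K : ℝ} (ht : 0 < t) (hm : 1 ≤ m)
    (hK : 0 ≤ K) (w : H) :
    (‖w‖ ^ 2) ^ (t + 1) ≤
      2 * superquadraticAux S A t m K 0 w + (2 * K) ^ (t + 1) * (‖S w‖ ^ 2) ^ (t + 1) := by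
  have ht1 : t + 1 ≠ 0 := by linarith
  simp only [superquadraticAux, ne_eq, OfNat.ofNat_ne_zero, not_false_eq_true, zero_pow, add_zero,
    Real.zero_rpow ht1, sub_zero]
  set σ := m ^ 2 * ‖S w‖ ^ 2 + ‖A w‖ ^ 2
  set X := ‖S w‖ ^ 2
  have hX : 0 ≤ X := by positivity
  have hσ : 0 ≤ σ := by positivity
  have hwσ : ‖w‖ ^ 2 ≤ σ := by
    rw [← hSA w]
    have h1 : 1 ≤ m ^ 2 := by nlinarith
    simp only [σ]
    nlinarith
  have h1 : (‖w‖ ^ 2) ^ (t + 1) ≤ σ ^ (t + 1) := by gcongr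
  have h2 : σ ^ (t + 1) = σ ^ t * σ := Real.rpow_add_one' hσ ht1
  have hT : 0 ≤ σ ^ t := by positivity
  rw [← Real.mul_rpow (by positivity) hX]
  have h3 : 2 * K * (σ ^ t * X) ≤ σ ^ (t + 1) + (2 * K * X) ^ (t + 1) := by
    rcases le_total (2 * K * X) σ with h | h
    · have := mul_le_mul_of_nonneg_left h hT
      have h' : 0 ≤ (2 * K * X) ^ (t + 1) := by positivity
      linarith
    · have h4 : (2 * K * X) ^ (t + 1) = (2 * K * X) ^ t * (2 * K * X) :=
        Real.rpow_add_one' (by positivity) ht1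
      have h5 : σ ^ t * (2 * K * X) ≤ (2 * K * X) ^ t * (2 * K * X) := by gcongr
      have h' : 0 ≤ σ ^ (t + 1) := by positivity
      linarith
  linarith

lemma continuous_uncurry_superquadraticAux (S A : H →L[ℝ] H) {t : ℝ} (ht : 0 ≤ t) (m K : ℝ) :
    Continuous (superquadraticAux S A t m K).uncurry := by
  have h1 : 0 ≤ t + 1 := by linarith
  have hb : Continuous fun q : ℝ × H => m ^ 2 * ‖S q.2‖ ^ 2 + ‖A q.2‖ ^ 2 + q.1 ^ 2 := by
    fun_prop
  have he : Continuous fun q : ℝ × H => (q.1 ^ 2) ^ (t + 1) :=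
    Continuous.rpow_const (by fun_prop) fun _ => Or.inr h1
  have hX : Continuous fun q : ℝ × H => ‖S q.2‖ ^ 2 := by fun_prop
  exact ((hb.rpow_const fun _ => Or.inr h1).sub
    (continuous_const.mul ((hb.rpow_const fun _ => Or.inr ht).mul hX))).sub he

variable [FiniteDimensional ℝ H]

lemma integral_norm_rpow_le_of_le_two (hn : 0 < n) {S A : H →L[ℝ] H}
    (hSA : ∀ z, ‖S z‖ ^ 2 + ‖A z‖ ^ 2 = ‖z‖ ^ 2) {p : ℝ} (hp : 1 < p) (hp2 : p ≤ 2)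
    {z : Eu n → H} (hz : ContDiff ℝ 2 z) (hzc : HasCompactSupport z)
    (hd : ∀ s x, ∑ i, ‖A (gaussAvg s (partialD i z) x)‖ ^ 2 ≤
      4 * ∑ i, ‖S (gaussAvg s (partialD i z) x)‖ ^ 2) :
    ∫ x, ‖z x‖ ^ p ≤ 5 / (p - 1) * ∫ x, ‖S (z x)‖ ^ p := by
  set K := 5 / (2 * (p / 2) - 1) with hK
  have hzero : ∀ e, subquadraticAux S (p / 2) K e 0 = 0 := fun e => by simp [subquadraticAux]
  have hcont : Continuous (subquadraticAux S (p / 2) K).uncurry := by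
    have hp' : 0 ≤ p / 2 := by linarith
    unfold subquadraticAux Function.uncurry
    refine ((Continuous.rpow_const ?_ fun _ => Or.inr hp').sub
      (continuous_const.mul (Continuous.rpow_const ?_ fun _ => Or.inr hp'))).sub
      ((Continuous.rpow_const ?_ fun _ => Or.inr hp').sub
      (continuous_const.mul (Continuous.rpow_const ?_ fun _ => Or.inr hp'))) <;> fun_prop
  have hmain := integral_comp_nonpos_of_forall_ne_zero hz.continuous hzc hcont hzero
    fun e he => integral_comp_nonpos_of_hessian_nonpos hn
      (contDiff_subquadraticAux S (p / 2) K he) (hzero e) (fderiv_subquadraticAux_zero S _ K he)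
      hz hzc fun s x => sum_hessian_subquadraticAux_nonpos hSA (by linarith) (by linarith) he _ _
        (hd s x)
  have hsq : ∀ w : H, (‖w‖ ^ 2) ^ (p / 2) = ‖w‖ ^ p := fun w => by
    rw [← Real.rpow_natCast, ← Real.rpow_mul (norm_nonneg w)]
    congr 1
    push_cast
    ring
  have hp0 : p / 2 ≠ 0 := by linarith
  have hpp : 0 ≤ p := by linarith
  simp only [subquadraticAux, ne_eq, OfNat.ofNat_ne_zero, not_false_eq_true, zero_pow, add_zero,
    Real.zero_rpow hp0, mul_zero, sub_zero, hsq] at hmain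
  have hi1 : Integrable fun x => ‖z x‖ ^ p :=
    (hz.continuous.norm.rpow_const fun _ => Or.inr hpp).integrable_of_hasCompactSupport
      (hzc.comp_left (g := fun w => ‖w‖ ^ p) (by simp [Real.zero_rpow (by linarith : p ≠ 0)]))
  have hi2 : Integrable fun x => ‖S (z x)‖ ^ p :=
    ((S.continuous.comp hz.continuous).norm.rpow_const
      fun _ => Or.inr hpp).integrable_of_hasCompactSupport
      (hzc.comp_left (g := fun w => ‖S w‖ ^ p) (by simp [Real.zero_rpow (by linarith : p ≠ 0)]))
  rw [integral_sub hi1 (hi2.const_mul K), integral_const_mul] at hmain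
  rw [show 5 / (p - 1) = K by rw [hK]; ring_nf]
  linarith

lemma integral_norm_rpow_le_of_two_lt (hn : 0 < n) {S A : H →L[ℝ] H}
    (hSA : ∀ z, ‖S z‖ ^ 2 + ‖A z‖ ^ 2 = ‖z‖ ^ 2) {t m K : ℝ} (ht : 0 < t) (hm : 4 ≤ m)
    (hmt : 20 * t ≤ m) (hK : (t + 1) * (2 * t + 1) * (2 * (m ^ 2 + 4)) ≤ K)
    {z : Eu n → H} (hz : ContDiff ℝ 2 z) (hzc : HasCompactSupport z)
    (hd : ∀ s x, ∑ i, ‖A (gaussAvg s (partialD i z) x)‖ ^ 2 ≤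
      4 * ∑ i, ‖S (gaussAvg s (partialD i z) x)‖ ^ 2) :
    ∫ x, ‖z x‖ ^ (2 * (t + 1)) ≤ (2 * K) ^ (t + 1) * ∫ x, ‖S (z x)‖ ^ (2 * (t + 1)) := by
  have hK0 : 0 < K := lt_of_lt_of_le (by positivity) hK
  have ht1 : t + 1 ≠ 0 := by linarith
  have hzero : ∀ e, superquadraticAux S A t m K e 0 = 0 := fun e => by simp [superquadraticAux]
  have hmain := integral_comp_nonpos_of_forall_ne_zero hz.continuous hzc
    (continuous_uncurry_superquadraticAux S A ht.le m K) hzero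
    fun e he => integral_comp_nonpos_of_hessian_nonpos hn
      (contDiff_superquadraticAux S A t m K he) (hzero e)
      (fderiv_superquadraticAux_zero S A t m K he)
      hz hzc fun s x => sum_hessian_superquadraticAux_nonpos ht hm hmt hK he _ _ (hd s x)
  have hsq : ∀ w : H, ‖w‖ ^ (2 * (t + 1)) = (‖w‖ ^ 2) ^ (t + 1) := fun w => by
    rw [Real.rpow_mul (norm_nonneg w), Real.rpow_two]
  simp_rw [hsq]
  have hcz : ∀ {g : H → ℝ}, Continuous g → g 0 = 0 → Integrable fun x => g (z x) :=
    fun hg hg0 => (hg.comp hz.continuous).integrable_of_hasCompactSupport (hzc.comp_left hg0)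
  have hi1 : Integrable fun x => (‖z x‖ ^ 2) ^ (t + 1) :=
    hcz (g := fun w => (‖w‖ ^ 2) ^ (t + 1)) (Continuous.rpow_const (by fun_prop)
      fun _ => Or.inr (by linarith)) (by simp [Real.zero_rpow ht1])
  have hi2 : Integrable fun x => (‖S (z x)‖ ^ 2) ^ (t + 1) :=
    hcz (g := fun w => (‖S w‖ ^ 2) ^ (t + 1)) (Continuous.rpow_const (by fun_prop)
      fun _ => Or.inr (by linarith)) (by simp [Real.zero_rpow ht1])
  have hi3 : Integrable fun x => superquadraticAux S A t m K 0 (z x) :=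
    hcz ((continuous_uncurry_superquadraticAux S A ht.le m K).uncurry_left 0) (hzero 0)
  have := integral_mono hi1 ((hi3.const_mul 2).add (hi2.const_mul ((2 * K) ^ (t + 1))))
    fun x => norm_sq_rpow_le_superquadraticAux hSA ht (by linarith) hK0.le (z x)
  simp only [Pi.add_apply] at this
  rw [integral_add (hi3.const_mul 2) (hi2.const_mul _), integral_const_mul,
    integral_const_mul] at this
  linarith

lemma exists_integral_norm_rpow_le (hn : 0 < n) {S A : H →L[ℝ] H}
    (hSA : ∀ z, ‖S z‖ ^ 2 + ‖A z‖ ^ 2 = ‖z‖ ^ 2) {p : ℝ} (hp : 1 < p) :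
    ∃ C > 0, ∀ z : Eu n → H, ContDiff ℝ 2 z → HasCompactSupport z →
      (∀ s x, ∑ i, ‖A (gaussAvg s (partialD i z) x)‖ ^ 2 ≤
        4 * ∑ i, ‖S (gaussAvg s (partialD i z) x)‖ ^ 2) →
      ∫ x, ‖z x‖ ^ p ≤ C * ∫ x, ‖S (z x)‖ ^ p := by
  rcases le_or_gt p 2 with h | h
  · exact ⟨5 / (p - 1), div_pos (by norm_num) (by linarith), fun z hz hzc hd =>
      integral_norm_rpow_le_of_le_two hn hSA hp h hz hzc hd⟩
  · set t := (p - 2) / 2 with ht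
    have ht0 : 0 < t := by rw [ht]; linarith
    have hpt : p = 2 * (t + 1) := by rw [ht]; ring
    have hK : 0 < (t + 1) * (2 * t + 1) * (2 * (max 4 (20 * t) ^ 2 + 4)) := by positivity
    refine ⟨(2 * ((t + 1) * (2 * t + 1) * (2 * (max 4 (20 * t) ^ 2 + 4)))) ^ (t + 1),
      Real.rpow_pos_of_pos (by linarith) _, fun z hz hzc hd => ?_⟩
    rw [hpt]
    exact integral_norm_rpow_le_of_two_lt hn hSA ht0 (le_max_left _ _) (le_max_right _ _) le_rfl
      hz hzc hd

end Korn

/-! ### Symmetric and skew parts of matrix fields -/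

/-- Transposition of matrices, viewed as vectors of entries. -/
def entrySwap : EuclideanSpace ℝ (Fin n × Fin n) ≃ₗᵢ[ℝ] EuclideanSpace ℝ (Fin n × Fin n) :=
  LinearIsometryEquiv.piLpCongrLeft 2 ℝ ℝ (Equiv.prodComm (Fin n) (Fin n))

/-- The symmetric part of a matrix, viewed as a vector of entries. -/
def entrySym : EuclideanSpace ℝ (Fin n × Fin n) →L[ℝ] EuclideanSpace ℝ (Fin n × Fin n) :=
  (1 / 2 : ℝ) • (ContinuousLinearMap.id ℝ _ +
    (entrySwap (n := n)).toContinuousLinearEquiv.toContinuousLinearMap)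

/-- The skew part of a matrix, viewed as a vector of entries. -/
def entrySkew : EuclideanSpace ℝ (Fin n × Fin n) →L[ℝ] EuclideanSpace ℝ (Fin n × Fin n) :=
  (1 / 2 : ℝ) • (ContinuousLinearMap.id ℝ _ -
    (entrySwap (n := n)).toContinuousLinearEquiv.toContinuousLinearMap)

lemma entrySym_apply (z : EuclideanSpace ℝ (Fin n × Fin n)) (i j : Fin n) :
    entrySym z (i, j) = 1 / 2 * (z (i, j) + z (j, i)) := by
  simp [entrySym, entrySwap, LinearIsometryEquiv.piLpCongrLeft_apply, mul_add]

lemma entrySkew_apply (z : EuclideanSpace ℝ (Fin n × Fin n)) (i j : Fin n) :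
    entrySkew z (i, j) = 1 / 2 * (z (i, j) - z (j, i)) := by
  simp [entrySkew, entrySwap, LinearIsometryEquiv.piLpCongrLeft_apply]

lemma norm_entrySym_sq_add (z : EuclideanSpace ℝ (Fin n × Fin n)) :
    ‖entrySym z‖ ^ 2 + ‖entrySkew z‖ ^ 2 = ‖z‖ ^ 2 := by
  have h := parallelogram_law_with_norm ℝ z (entrySwap z)
  rw [LinearIsometryEquiv.norm_map] at h
  have h1 : entrySym z = (1 / 2 : ℝ) • (z + entrySwap z) := rfl
  have h2 : entrySkew z = (1 / 2 : ℝ) • (z - entrySwap z) := rfl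
  rw [h1, h2, norm_smul, norm_smul, mul_pow, mul_pow]
  norm_num
  linarith

/-- The pointwise algebraic identity behind Korn's inequality: the gradient of the skew part of a
gradient field is controlled by the gradient of its symmetric part. -/
lemma sum_norm_entrySkew_sq_le {a : Fin n → EuclideanSpace ℝ (Fin n × Fin n)}
    (ha : ∀ i j k, a i (k, j) = a j (k, i)) :
    ∑ i, ‖entrySkew (a i)‖ ^ 2 ≤ 4 * ∑ i, ‖entrySym (a i)‖ ^ 2 := by
  simp only [EuclideanSpace.real_norm_sq_eq, Fintype.sum_prod_type]
  set e : Fin n → Fin n → Fin n → ℝ := fun i k j => entrySym (a i) (k, j) with he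
  have hpoint : ∀ i k j, entrySkew (a i) (k, j) ^ 2 ≤ 2 * e j k i ^ 2 + 2 * e k i j ^ 2 := by
    intro i k j
    have : entrySkew (a i) (k, j) = e j k i - e k i j := by
      simp only [he, entrySym_apply, entrySkew_apply]
      rw [ha j i k, ha k j i, ha k i j]
      ring
    rw [this]
    nlinarith [sq_nonneg (e j k i + e k i j)]
  calc ∑ i, ∑ k, ∑ j, entrySkew (a i) (k, j) ^ 2
      ≤ ∑ i, ∑ k, ∑ j, (2 * e j k i ^ 2 + 2 * e k i j ^ 2) := by
        gcongr with i _ k _ j _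
        exact hpoint i k j
    _ = 2 * ∑ i, ∑ k, ∑ j, e j k i ^ 2 + 2 * ∑ i, ∑ k, ∑ j, e k i j ^ 2 := by
        simp only [Finset.sum_add_distrib, Finset.mul_sum]
    _ = 2 * ∑ i, ∑ k, ∑ j, e i k j ^ 2 + 2 * ∑ i, ∑ k, ∑ j, e i k j ^ 2 := by
        congr 2
        · calc ∑ i, ∑ k, ∑ j, e j k i ^ 2 = ∑ i, ∑ j, ∑ k, e j k i ^ 2 :=
                Finset.sum_congr rfl fun i _ => Finset.sum_comm
            _ = ∑ j, ∑ i, ∑ k, e j k i ^ 2 := Finset.sum_comm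
            _ = _ := Finset.sum_congr rfl fun j _ => Finset.sum_comm
        · exact Finset.sum_comm
    _ = _ := by ring

lemma exists_integral_norm_rpow_le_entrySym (hn : 0 < n) {p : ℝ} (hp : 1 < p) :
    ∃ C > 0, ∀ z : Eu n → EuclideanSpace ℝ (Fin n × Fin n), ContDiff ℝ 2 z →
      HasCompactSupport z → (∀ i j k x, partialD i z x (k, j) = partialD j z x (k, i)) →
      ∫ x, ‖z x‖ ^ p ≤ C * ∫ x, ‖entrySym (z x)‖ ^ p := by
  obtain ⟨C, hC, h⟩ := exists_integral_norm_rpow_le hn norm_entrySym_sq_add hp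
  refine ⟨C, hC, fun z hz hzc hcurl => h z hz hzc fun s x => sum_norm_entrySkew_sq_le ?_⟩
  intro i j k
  have hcont : ∀ i, Continuous (partialD i z) := fun i =>
    (ContDiff.partialD (k := 1) (by norm_cast at hz) i).continuous
  have hproj : ∀ i (q : Fin n × Fin n), gaussAvg s (partialD i z) x q =
      gaussAvg s (fun x => partialD i z x q) x := fun i q =>
    ((EuclideanSpace.proj q : EuclideanSpace ℝ (Fin n × Fin n) →L[ℝ] ℝ).gaussAvg_comp
      (hcont i) (hzc.partialD i) s x).symm
  rw [hproj, hproj]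
  simp_rw [hcurl i j k]

/-! ### Nonlocal difference operators -/

section NonlocalDifference

variable {F : Type*} [NormedAddCommGroup F] [NormedSpace ℝ F]

/-- The nonlocal difference operator with kernel `k`. -/
def nlDiff (k : Eu n → ℝ) (f : Eu n → F) (x : Eu n) : F :=
  ∫ h, k h • (f x - f (x - h))

/-- The integrability condition under which nonlocal differences of Lipschitz functions are
defined. -/
def IsDiffKernel (k : Eu n → ℝ) : Prop :=
  AEStronglyMeasurable k ∧ Integrable fun h => ‖h‖ * ‖k h‖

variable {k : Eu n → ℝ}

lemma norm_smul_sub_le {f : Eu n → F} {C : NNReal} (hf : LipschitzWith C f) (x h : Eu n) :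
    ‖k h • (f x - f (x - h))‖ ≤ C * (‖h‖ * ‖k h‖) := by
  have := hf.norm_sub_le x (x - h)
  rw [sub_sub_cancel] at this
  rw [norm_smul]
  nlinarith [mul_le_mul_of_nonneg_left this (norm_nonneg (k h))]

lemma IsDiffKernel.aestronglyMeasurable (hk : IsDiffKernel k) {f : Eu n → F} (hf : Continuous f)
    (x : Eu n) : AEStronglyMeasurable (fun h => k h • (f x - f (x - h))) :=
  hk.1.smul (by fun_prop : Continuous fun h => f x - f (x - h)).aestronglyMeasurable

lemma IsDiffKernel.integrable (hk : IsDiffKernel k) {f : Eu n → F} {C : NNReal}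
    (hf : LipschitzWith C f) (x : Eu n) : Integrable (fun h => k h • (f x - f (x - h))) :=
  (hk.2.const_mul C).mono' (hk.aestronglyMeasurable hf.continuous x)
    (.of_forall fun h => norm_smul_sub_le hf x h)

lemma IsDiffKernel.hasFDerivAt_nlDiff (hk : IsDiffKernel k) {f : Eu n → F}
    (hf : ContDiff ℝ (⊤ : ℕ∞) f) (hfc : HasCompactSupport f) (x : Eu n) :
    HasFDerivAt (nlDiff k f) (nlDiff k (fderiv ℝ f) x) x := by
  obtain ⟨C, hC⟩ := hf.lipschitzWith_of_hasCompactSupport hfc (by simp)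
  have hf' : ContDiff ℝ (⊤ : ℕ∞) (fderiv ℝ f) := hf.fderiv_right (by simp)
  obtain ⟨D, hD⟩ := hf'.lipschitzWith_of_hasCompactSupport (hfc.fderiv ℝ) (by simp)
  have hdiff : ∀ y, HasFDerivAt f (fderiv ℝ f y) y := fun y =>
    (hf.differentiable (by simp) y).hasFDerivAt
  refine hasFDerivAt_integral_of_dominated_of_fderiv_le (s := univ)
    (F' := fun x h => k h • (fderiv ℝ f x - fderiv ℝ f (x - h)))
    (bound := fun h => D * (‖h‖ * ‖k h‖)) Filter.univ_mem
    (.of_forall fun y => hk.aestronglyMeasurable hf.continuous y) (hk.integrable hC x)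
    (hk.aestronglyMeasurable hf'.continuous x)
    (.of_forall fun h y _ => norm_smul_sub_le hD y h) (hk.2.const_mul D)
    (.of_forall fun h y _ => ?_)
  exact ((hdiff y).sub ((hasFDerivAt_comp_sub h).2 (hdiff (y - h)))).const_smul (k h)

lemma IsDiffKernel.partialD_nlDiff [CompleteSpace F] (hk : IsDiffKernel k) {f : Eu n → F}
    (hf : ContDiff ℝ (⊤ : ℕ∞) f) (hfc : HasCompactSupport f) (i : Fin n) (x : Eu n) :
    partialD i (nlDiff k f) x = nlDiff k (partialD i f) x := by
  have hf' : ContDiff ℝ (⊤ : ℕ∞) (fderiv ℝ f) := hf.fderiv_right (by simp)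
  obtain ⟨D, hD⟩ := hf'.lipschitzWith_of_hasCompactSupport (hfc.fderiv ℝ) (by simp)
  rw [partialD, (hk.hasFDerivAt_nlDiff hf hfc x).fderiv, nlDiff,
    ContinuousLinearMap.integral_apply (hk.integrable hD x)]
  rfl

lemma IsDiffKernel.contDiff_nlDiff (hk : IsDiffKernel k) {f : Eu n → F}
    (hf : ContDiff ℝ (⊤ : ℕ∞) f) (hfc : HasCompactSupport f) (m : ℕ) :
    ContDiff ℝ m (nlDiff k f) := by
  induction m generalizing F with
  | zero =>
    obtain ⟨C, hC⟩ := hf.lipschitzWith_of_hasCompactSupport hfc (by simp)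
    refine contDiff_zero.2 (continuous_of_dominated
      (fun x => hk.aestronglyMeasurable hf.continuous x)
      (fun x => .of_forall fun h => norm_smul_sub_le hC x h) (hk.2.const_mul C)
      (.of_forall fun h => ?_))
    have := hf.continuous
    fun_prop
  | succ m ih =>
    exact contDiff_succ_iff_hasFDerivAt.2 ⟨nlDiff k (fderiv ℝ f),
      ih (hf.fderiv_right (by simp)) (hfc.fderiv ℝ), fun x => hk.hasFDerivAt_nlDiff hf hfc x⟩

open scoped Pointwise in
lemma HasCompactSupport.nlDiff (hkc : HasCompactSupport k) {f : Eu n → F}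
    (hfc : HasCompactSupport f) : HasCompactSupport (nlDiff k f) := by
  refine HasCompactSupport.intro (K := tsupport f ∪ (tsupport f + tsupport k))
    (hfc.isCompact.union (hfc.isCompact.add hkc.isCompact)) fun x hx => ?_
  rw [mem_union, not_or] at hx
  refine integral_eq_zero_of_ae (.of_forall fun h => ?_)
  by_cases hh : h ∈ tsupport k
  · have : x - h ∉ tsupport f := fun h' => hx.2 ⟨x - h, h', h, hh, sub_add_cancel x h⟩
    simp [image_eq_zero_of_notMem_tsupport hx.1, image_eq_zero_of_notMem_tsupport this]
  · simp [image_eq_zero_of_notMem_tsupport hh]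

end NonlocalDifference

/-! ### Rotations in coordinate planes and curl-free nonlocal gradients -/

/-- The rotation by the angle `θ` in the plane spanned by the `i`-th and `j`-th basis vectors. -/
def planeRot {i j : Fin n} (hij : i ≠ j) (θ : ℝ) : Eu n →ₗᵢ[ℝ] Eu n where
  toFun h := h + ((Real.cos θ - 1) * h i - Real.sin θ * h j) • EuclideanSpace.single i 1 +
    (Real.sin θ * h i + (Real.cos θ - 1) * h j) • EuclideanSpace.single j 1
  map_add' h h' := by
    simp only [PiLp.add_apply]
    module
  map_smul' c h := by
    simp only [PiLp.smul_apply, smul_eq_mul, RingHom.id_apply]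
    module
  norm_map' h := by
    rw [← sq_eq_sq₀ (norm_nonneg _) (norm_nonneg _)]
    simp only [LinearMap.coe_mk, AddHom.coe_mk]
    rw [norm_add_sq_real, norm_add_sq_real]
    simp only [inner_add_left, inner_smul_left, inner_smul_right, EuclideanSpace.inner_single_right,
      norm_smul, PiLp.norm_single, PiLp.single_apply, hij.symm, mul_pow, Real.norm_eq_abs,
      sq_abs]
    simp
    linear_combination (h i ^ 2 + h j ^ 2) * Real.sin_sq_add_cos_sq θ

section Rotation

variable {i j : Fin n} (hij : i ≠ j)

lemma planeRot_apply (θ : ℝ) (h : Eu n) : planeRot hij θ h =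
    h + ((Real.cos θ - 1) * h i - Real.sin θ * h j) • EuclideanSpace.single i 1 +
    (Real.sin θ * h i + (Real.cos θ - 1) * h j) • EuclideanSpace.single j 1 := rfl

lemma planeRot_zero (h : Eu n) : planeRot hij 0 h = h := by simp [planeRot_apply]

lemma hasDerivAt_planeRot (θ : ℝ) (h : Eu n) : HasDerivAt (fun θ => planeRot hij θ h)
    ((-Real.sin θ * h i - Real.cos θ * h j) • EuclideanSpace.single i 1 +
      (Real.cos θ * h i - Real.sin θ * h j) • EuclideanSpace.single j (1 : ℝ)) θ := by
  simp only [planeRot_apply]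
  have hc := (Real.hasDerivAt_cos θ).sub_const 1
  have hs := Real.hasDerivAt_sin θ
  have h1 := ((hc.mul_const (h i)).sub (hs.mul_const (h j))).smul_const
    (EuclideanSpace.single i (1 : ℝ))
  have h2 := ((hs.mul_const (h i)).add (hc.mul_const (h j))).smul_const
    (EuclideanSpace.single j (1 : ℝ))
  convert! (h1.const_add h).add h2 using 1
  module

lemma norm_deriv_planeRot_le (θ : ℝ) (h : Eu n) :
    ‖(-Real.sin θ * h i - Real.cos θ * h j) • EuclideanSpace.single i 1 +
      (Real.cos θ * h i - Real.sin θ * h j) • EuclideanSpace.single j (1 : ℝ)‖ ≤ 4 * ‖h‖ := by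
  have hcoord : ∀ l, |h l| ≤ ‖h‖ := fun l => by simpa using PiLp.norm_apply_le h l
  have hs : ∀ l, |Real.sin θ * h l| ≤ ‖h‖ := fun l => by
    rw [abs_mul]
    exact (mul_le_of_le_one_left (abs_nonneg _) (Real.abs_sin_le_one θ)).trans (hcoord l)
  have hc : ∀ l, |Real.cos θ * h l| ≤ ‖h‖ := fun l => by
    rw [abs_mul]
    exact (mul_le_of_le_one_left (abs_nonneg _) (Real.abs_cos_le_one θ)).trans (hcoord l)
  refine (norm_add_le _ _).trans ?_
  simp only [norm_smul, PiLp.norm_single, norm_one, mul_one, Real.norm_eq_abs]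
  have h1 := abs_sub (-Real.sin θ * h i) (Real.cos θ * h j)
  have h2 := abs_sub (Real.cos θ * h i) (Real.sin θ * h j)
  rw [neg_mul, abs_neg] at h1
  rw [neg_mul]
  linarith [hs i, hs j, hc i, hc j]

lemma integral_comp_planeRot (θ : ℝ) (g : Eu n → ℝ) :
    ∫ h, g (planeRot hij θ h) = ∫ h, g h :=
  ((planeRot hij θ).toLinearIsometryEquiv rfl).measurePreserving.integral_comp
    ((planeRot hij θ).toLinearIsometryEquiv rfl).toHomeomorph.measurableEmbedding g

end Rotation

lemma norm_taylor_le {f : Eu n → ℝ} (hf : Differentiable ℝ f) {C : NNReal}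
    (hC : LipschitzWith C (fderiv ℝ f)) (x h : Eu n) :
    ‖f (x - h) - f x + fderiv ℝ f x h‖ ≤ C * ‖h‖ ^ 2 := by
  have hd : ∀ y, HasFDerivAt (fun y => f (x - y) + fderiv ℝ f x y)
      (-fderiv ℝ f (x - y) + fderiv ℝ f x) y := fun y => by
    have h1 := (hf (x - y)).hasFDerivAt.comp y ((hasFDerivAt_id y).const_sub x)
    convert! h1.add (fderiv ℝ f x).hasFDerivAt using 1
    ext v
    simp
  have := (convex_closedBall (0 : Eu n) ‖h‖).norm_image_sub_le_of_norm_hasFDerivWithin_le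
    (C := C * ‖h‖) (x := 0) (y := h) (fun y _ => (hd y).hasFDerivWithinAt) (fun y hy => ?_)
    (by simp) (by simp)
  · simp only [sub_zero, map_zero, add_zero] at this
    rwa [pow_two, ← mul_assoc, sub_add_eq_add_sub]
  · rw [neg_add_eq_sub]
    have h1 := hC.norm_sub_le x (x - y)
    rw [sub_sub_cancel] at h1
    exact h1.trans (by gcongr; simpa using hy)

lemma isDiffKernel_coord_mul {m : Eu n → ℝ} (hm : AEStronglyMeasurable m)
    (hmi : Integrable fun h => ‖h‖ ^ 2 * ‖m h‖) (l : Fin n) : IsDiffKernel fun h => h l * m h := by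
  have hms : AEStronglyMeasurable fun h : Eu n => h l * m h :=
    (by fun_prop : Continuous fun h : Eu n => h l).aestronglyMeasurable.mul hm
  refine ⟨hms, hmi.mono' (by fun_prop) (.of_forall fun h => ?_)⟩
  have : ‖h l‖ ≤ ‖h‖ := PiLp.norm_apply_le h l
  rw [norm_mul, norm_norm, norm_norm, norm_mul, pow_two, mul_assoc]
  gcongr

/-- Nonlocal gradients with a radial kernel are curl-free. -/
lemma nlDiff_partialD_comm {m : Eu n → ℝ} (hm : AEStronglyMeasurable m)
    (hmi : Integrable fun h => ‖h‖ ^ 2 * ‖m h‖) (hrad : ∀ h h', ‖h‖ = ‖h'‖ → m h = m h')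
    {f : Eu n → ℝ} (hf : ContDiff ℝ (⊤ : ℕ∞) f) (hfc : HasCompactSupport f) (i j : Fin n)
    (x : Eu n) :
    nlDiff (fun h => h j * m h) (partialD i f) x = nlDiff (fun h => h i * m h) (partialD j f) x := by
  rcases eq_or_ne i j with rfl | hij
  · rfl
  have hf' : ContDiff ℝ (⊤ : ℕ∞) (fderiv ℝ f) := hf.fderiv_right (by simp)
  obtain ⟨D, hD⟩ := hf'.lipschitzWith_of_hasCompactSupport (hfc.fderiv ℝ) (by simp)
  have hdiff := hf.differentiable (by simp)
  have hcf := hf.continuous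
  have hcf' := hf'.continuous
  set F : ℝ → Eu n → ℝ := fun θ h =>
    m h * (f (x - planeRot hij θ h) - f x + fderiv ℝ f x (planeRot hij θ h)) with hF
  set R' : ℝ → Eu n → Eu n := fun θ h =>
    (-Real.sin θ * h i - Real.cos θ * h j) • EuclideanSpace.single i 1 +
      (Real.cos θ * h i - Real.sin θ * h j) • EuclideanSpace.single j (1 : ℝ) with hR'
  set F' : ℝ → Eu n → ℝ := fun θ h =>
    m h * ((fderiv ℝ f x - fderiv ℝ f (x - planeRot hij θ h)) (R' θ h)) with hF'
  have hmeas : ∀ θ, AEStronglyMeasurable (F θ) := fun θ => by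
    have hR := (planeRot hij θ).continuous
    exact hm.mul (by fun_prop : Continuous fun h =>
      f (x - planeRot hij θ h) - f x + fderiv ℝ f x (planeRot hij θ h)).aestronglyMeasurable
  have hinteg : Integrable (F 0) := by
    refine (hmi.const_mul D).mono' (hmeas 0) (.of_forall fun h => ?_)
    simp only [hF, planeRot_zero, norm_mul]
    nlinarith [mul_le_mul_of_nonneg_left (norm_taylor_le hdiff hD x h) (norm_nonneg (m h))]
  have hmeas' : AEStronglyMeasurable (F' 0) := by
    have hR := (planeRot hij 0).continuous
    have hR0 : Continuous (R' 0) := by simp only [hR']; fun_prop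
    exact hm.mul (by fun_prop : Continuous fun h =>
      (fderiv ℝ f x - fderiv ℝ f (x - planeRot hij 0 h)) (R' 0 h)).aestronglyMeasurable
  have hderiv := (hasDerivAt_integral_of_dominated_loc_of_deriv_le (μ := volume) (x₀ := (0 : ℝ))
    (s := univ) (F := F) (F' := F') (bound := fun h => 4 * D * (‖h‖ ^ 2 * ‖m h‖)) Filter.univ_mem
    (.of_forall hmeas) hinteg hmeas' (.of_forall fun h θ _ => ?_) (hmi.const_mul _)
    (.of_forall fun h θ _ => ?_)).2
  · have hconst : (fun θ => ∫ h, F θ h) = fun _ => ∫ h, F 0 h := by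
      ext θ
      rw [← integral_comp_planeRot hij θ (F 0)]
      refine integral_congr_ae (.of_forall fun h => ?_)
      simp only [hF, planeRot_zero]
      rw [hrad (planeRot hij θ h) h ((planeRot hij θ).norm_map h)]
    rw [hconst] at hderiv
    have h0 := hderiv.unique (hasDerivAt_const (0 : ℝ) (∫ h, F 0 h))
    have hpi : ∀ l, ContDiff ℝ (⊤ : ℕ∞) (partialD l f) := fun l => hf'.clm_apply contDiff_const
    have hker := isDiffKernel_coord_mul hm hmi
    have hinteg' : ∀ l l', Integrable fun h => (h l * m h) • (partialD l' f x - partialD l' f (x - h)) :=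
      fun l l' => by
        obtain ⟨C, hC⟩ := (hpi l').lipschitzWith_of_hasCompactSupport (hfc.partialD l') (by simp)
        exact (hker l).integrable hC x
    have hsplit : ∀ h, F' 0 h = (h i * m h) • (partialD j f x - partialD j f (x - h)) -
        (h j * m h) • (partialD i f x - partialD i f (x - h)) := fun h => by
      simp only [hF', hR', planeRot_zero, partialD, Real.sin_zero, Real.cos_zero, map_add, map_smul,
        _root_.sub_apply, smul_eq_mul]
      ring
    simp_rw [hsplit] at h0
    rw [integral_sub (hinteg' i j) (hinteg' j i)] at h0
    exact (sub_eq_zero.1 h0).symm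
  · have h1 : ‖fderiv ℝ f x - fderiv ℝ f (x - planeRot hij θ h)‖ ≤ D * ‖h‖ := by
      have := hD.norm_sub_le x (x - planeRot hij θ h)
      rwa [sub_sub_cancel, LinearIsometry.norm_map] at this
    have h2 := (ContinuousLinearMap.le_opNorm _ _).trans
      (mul_le_mul h1 (norm_deriv_planeRot_le (i := i) (j := j) θ h) (norm_nonneg _) (by positivity))
    simp only [hF', norm_mul]
    calc _ ≤ ‖m h‖ * (D * ‖h‖ * (4 * ‖h‖)) := by gcongr
      _ = _ := by ring
  · have hR := hasDerivAt_planeRot hij θ h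
    have h1 := (hdiff (x - planeRot hij θ h)).hasFDerivAt.comp_hasDerivAt θ (hR.const_sub x)
    have h2 := (fderiv ℝ f x).hasFDerivAt.comp_hasDerivAt θ hR
    convert! ((h1.sub_const (f x)).add h2).const_mul (m h) using 1
    simp only [hF', hR', map_neg, _root_.sub_apply]
    ring

/-! ### The nonlocal gradient as a vector of entries -/

/-- The nonlocal gradient of a vector field, viewed as a vector of entries. -/
def nlGradEntries (ρ : Eu n → ℝ) (u : Eu n → Eu n) (x : Eu n) : EuclideanSpace ℝ (Fin n × Fin n) :=
  WithLp.toLp 2 fun q => nlDiff (fun h => h q.2 * (ρ h / ‖h‖ ^ 2)) (fun y => u y q.1) x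

lemma nlGradEntries_apply (ρ : Eu n → ℝ) (u : Eu n → Eu n) (x : Eu n) (i j : Fin n) :
    nlGradEntries ρ u x (i, j) = nlGradM ρ u x i j := by
  simp only [nlGradEntries, nlDiff, nlGradM, Matrix.of_apply]
  rw [← integral_sub_left_eq_self _ volume x]
  refine integral_congr_ae (.of_forall fun y => ?_)
  simp only [nlGradMInt, sub_sub_cancel, smul_eq_mul, PiLp.sub_apply]
  ring

lemma norm_nlGradM (ρ : Eu n → ℝ) (u : Eu n → Eu n) (x : Eu n) :
    ‖nlGradM ρ u x‖ = ‖nlGradEntries ρ u x‖ := by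
  rw [Matrix.frobenius_norm_def, EuclideanSpace.norm_eq, Fintype.sum_prod_type, Real.sqrt_eq_rpow]
  simp [nlGradEntries_apply]

lemma norm_symPart_nlGradM (ρ : Eu n → ℝ) (u : Eu n → Eu n) (x : Eu n) :
    ‖symPart (nlGradM ρ u x)‖ = ‖entrySym (nlGradEntries ρ u x)‖ := by
  rw [Matrix.frobenius_norm_def, EuclideanSpace.norm_eq, Fintype.sum_prod_type, Real.sqrt_eq_rpow]
  simp [entrySym_apply, nlGradEntries_apply, symPart]

section Kernel

variable {ρ : Eu n → ℝ} {u : Eu n → Eu n}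

lemma aestronglyMeasurable_div_norm_sq (hρ : Integrable ρ) :
    AEStronglyMeasurable fun h => ρ h / ‖h‖ ^ 2 :=
  (hρ.aestronglyMeasurable.aemeasurable.div (by fun_prop)).aestronglyMeasurable

lemma integrable_norm_sq_mul_div (hρ : Integrable ρ) :
    Integrable fun h => ‖h‖ ^ 2 * ‖ρ h / ‖h‖ ^ 2‖ := by
  refine hρ.norm.mono' ?_ (.of_forall fun h => ?_)
  · have := aestronglyMeasurable_div_norm_sq hρ
    fun_prop
  · rcases eq_or_ne h 0 with rfl | hh
    · simp
    · have : ‖h‖ ≠ 0 := norm_ne_zero_iff.2 hh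
      simp only [norm_mul, norm_div, norm_pow, norm_norm]
      exact (mul_div_cancel₀ _ (pow_ne_zero 2 this)).le

lemma contDiff_nlGradEntries (hρ : Integrable ρ) (hu : ContDiff ℝ (⊤ : ℕ∞) u)
    (huc : HasCompactSupport u) (m : ℕ) : ContDiff ℝ m (nlGradEntries ρ u) := by
  refine contDiff_euclidean.2 fun q => ?_
  exact (isDiffKernel_coord_mul (aestronglyMeasurable_div_norm_sq hρ)
    (integrable_norm_sq_mul_div hρ) q.2).contDiff_nlDiff (contDiff_euclidean.1 hu q.1)
    (huc.comp_left (g := fun v : Eu n => v q.1) rfl) m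

lemma hasCompactSupport_nlGradEntries (hρ : HasCompactSupport ρ) (huc : HasCompactSupport u) :
    HasCompactSupport (nlGradEntries ρ u) := by
  have h : ∀ q, HasCompactSupport fun x => nlGradEntries ρ u x q := fun q => by
    refine HasCompactSupport.nlDiff (k := fun h => h q.2 * (ρ h / ‖h‖ ^ 2))
      (hρ.mono fun h hh => ?_) (huc.comp_left (g := fun v : Eu n => v q.1) rfl)
    contrapose! hh
    simp [Function.notMem_support.1 hh]
  refine HasCompactSupport.intro (K := ⋃ q, tsupport fun x => nlGradEntries ρ u x q)
    (isCompact_iUnion h) fun x hx => ?_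
  ext q
  exact image_eq_zero_of_notMem_tsupport (f := fun x => nlGradEntries ρ u x q)
    fun hq => hx (mem_iUnion.2 ⟨q, hq⟩)

lemma partialD_nlGradEntries (hρ : Integrable ρ) (hu : ContDiff ℝ (⊤ : ℕ∞) u)
    (huc : HasCompactSupport u) (i : Fin n) (x : Eu n) (q : Fin n × Fin n) :
    partialD i (nlGradEntries ρ u) x q =
      nlDiff (fun h => h q.2 * (ρ h / ‖h‖ ^ 2)) (partialD i fun y => u y q.1) x := by
  rw [← (isDiffKernel_coord_mul (aestronglyMeasurable_div_norm_sq hρ)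
    (integrable_norm_sq_mul_div hρ) q.2).partialD_nlDiff (contDiff_euclidean.1 hu q.1)
    (huc.comp_left (g := fun v : Eu n => v q.1) rfl)]
  have hd : DifferentiableAt ℝ (nlGradEntries ρ u) x :=
    (contDiff_nlGradEntries hρ hu huc 1).differentiable (by simp) x
  have := (EuclideanSpace.proj (𝕜 := ℝ) q).hasFDerivAt.comp x hd.hasFDerivAt
  simp only [partialD]
  exact (congrArg (fun L => L (EuclideanSpace.single i 1)) this.fderiv).symm

end Kernel

lemma ofReal_mul_eLpNorm_le_of_integral_le {α E F : Type*} [MeasurableSpace α] {μ : Measure α}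
    [NormedAddCommGroup E] [NormedAddCommGroup F] {p C : ℝ} (hp : 0 < p) (hC : 0 < C)
    {f : α → E} {g : α → F} (hf : MemLp f (ENNReal.ofReal p) μ) (hg : MemLp g (ENNReal.ofReal p) μ)
    (h : ∫ x, ‖f x‖ ^ p ∂μ ≤ C * ∫ x, ‖g x‖ ^ p ∂μ) :
    ENNReal.ofReal (C ^ (-p⁻¹)) * eLpNorm f (ENNReal.ofReal p) μ ≤
      eLpNorm g (ENNReal.ofReal p) μ := by
  have hp0 : ENNReal.ofReal p ≠ 0 := by simpa using hp
  rw [hf.eLpNorm_eq_integral_rpow_norm hp0 ENNReal.ofReal_ne_top,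
    hg.eLpNorm_eq_integral_rpow_norm hp0 ENNReal.ofReal_ne_top, ENNReal.toReal_ofReal hp.le,
    ← ENNReal.ofReal_mul (by positivity)]
  refine ENNReal.ofReal_le_ofReal ?_
  have hI : 0 ≤ ∫ x, ‖g x‖ ^ p ∂μ := integral_nonneg fun x => by positivity
  calc C ^ (-p⁻¹) * (∫ x, ‖f x‖ ^ p ∂μ) ^ p⁻¹
      ≤ C ^ (-p⁻¹) * (C * ∫ x, ‖g x‖ ^ p ∂μ) ^ p⁻¹ := by gcongr
    _ = (∫ x, ‖g x‖ ^ p ∂μ) ^ p⁻¹ := by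
      rw [Real.mul_rpow hC.le hI, ← mul_assoc, ← Real.rpow_add hC, neg_add_cancel, Real.rpow_zero,
        one_mul]

variable (n)

/-- nonlocal Korn inequality for general kernels. -/
theorem stmt4 (hn : 0 < n) (p : ℝ) (hp : 1 < p) (ρ : Eu n → ℝ) (ρb : ℝ → ℝ) (ε : ℝ)
    (h0 : IsKernelH0 n ρ ρb ε) (h1 : IsKernelH1 n ρb ε) (h2 : IsKernelH2 n ρb ε)
    (h3 : IsKernelH3 n ρb ε) (h4 : IsKernelH4 n ρb ε) (hsupp : HasCompactSupport ρ) :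
    ∃ c > (0 : ℝ), ∀ u : Eu n → Eu n, ContDiff ℝ (⊤ : ℕ∞) u → HasCompactSupport u →
      ENNReal.ofReal c * eLpNorm (fun x => nlGradM ρ u x) (ENNReal.ofReal p) volume ≤
        eLpNorm (fun x => symPart (nlGradM ρ u x)) (ENNReal.ofReal p) volume := by
  obtain ⟨-, hrad, hloc, -⟩ := h0
  have hρ : Integrable ρ := (integrableOn_iff_integrable_of_support_subset (subset_tsupport ρ)).1
    (hloc.integrableOn_isCompact hsupp)
  obtain ⟨C, hC, hkorn⟩ := exists_integral_norm_rpow_le_entrySym hn hp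
  have hp0 : 0 < p := one_pos.trans hp
  refine ⟨C ^ (-p⁻¹), by positivity, fun u hu huc => ?_⟩
  have hz := contDiff_nlGradEntries hρ hu huc 2
  have hzc := hasCompactSupport_nlGradEntries hsupp huc
  rw [eLpNorm_congr_norm_ae (.of_forall (norm_nlGradM ρ u)),
    eLpNorm_congr_norm_ae (.of_forall (norm_symPart_nlGradM ρ u))]
  refine ofReal_mul_eLpNorm_le_of_integral_le hp0 hC
    (hz.continuous.memLp_of_hasCompactSupport hzc)
    ((entrySym.continuous.comp hz.continuous).memLp_of_hasCompactSupport
      (hzc.comp_left (map_zero entrySym))) (hkorn _ hz hzc fun i j k x => ?_)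
  rw [partialD_nlGradEntries hρ hu huc, partialD_nlGradEntries hρ hu huc]
  refine nlDiff_partialD_comm (aestronglyMeasurable_div_norm_sq hρ) (integrable_norm_sq_mul_div hρ)
    (fun h h' hh => ?_) (contDiff_euclidean.1 hu k)
    (huc.comp_left (g := fun v : Eu n => v k) rfl) i j x
  rcases eq_or_ne h 0 with rfl | h_ne
  · simp [← hh]
  · rw [hrad h h_ne, hrad h' (norm_ne_zero_iff.1 (hh ▸ norm_ne_zero_iff.2 h_ne)), hh]
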